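/- There exist universal constants C > 0 and c ≥ 1 such that for every projection game G and every integer k ≥ 1, the entangled value of the k-fold repetition satisfies val*(G^{⊗k}) ≤ (1 − C·(1 − val*(G))^c)^{k/2}. -/

import Mathlib

noncomputable section
open scoped Kronecker ComplexOrder
open Matrix

/-- `d × d` complex matrices. -/
abbrev Mat (d : ℕ) := Matrix (Fin d) (Fin d) ℂ

/-- Entrywise complex conjugation of a matrix. -/
def mconj {m n : Type*} (M : Matrix m n ℂ) : Matrix m n ℂ := M.map (starRingEnd ℂ)

/-- Operator (spectral) norm of a square complex matrix. -/
noncomputable def opNorm {n : Type*} [Fintype n] [DecidableEq n] (M : Matrix n n ℂ) : ℝ :=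
  ‖Matrix.toEuclideanCLM (𝕜 := ℂ) M‖

/-- `⟨ψ| M |ψ⟩`. -/
def braket {ι : Type*} [Fintype ι] (ψ : ι → ℂ) (M : Matrix ι ι ℂ) : ℂ :=
  star ψ ⬝ᵥ M.mulVec ψ

/-- Squared Euclidean norm of a complex vector. -/
def enormSq {ι : Type*} [Fintype ι] (ψ : ι → ℂ) : ℝ := ∑ i, Complex.normSq (ψ i)

/-- A family of psd matrices summing to the identity. -/
def IsPOVM {d : ℕ} {α : Type*} [Fintype α] (M : α → Mat d) : Prop :=
  (∀ a, (M a).PosSemidef) ∧ (∑ a, M a) = 1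

/-- A two-player one-round projection game. -/
structure ProjGame where
  U : Type
  V : Type
  A : Type
  B : Type
  [fU : Fintype U]
  [fV : Fintype V]
  [fA : Fintype A]
  [fB : Fintype B]
  [dA : DecidableEq A]
  μ : U → V → ℝ
  μ_nonneg : ∀ u v, 0 ≤ μ u v
  μ_sum : ∑ u, ∑ v, μ u v = 1
  proj : U → V → B → Option A

attribute [instance] ProjGame.fU ProjGame.fV ProjGame.fA ProjGame.fB ProjGame.dA

namespace ProjGame

variable (G : ProjGame)

/-- Marginal distribution on first-player questions. -/
def μL (u : G.U) : ℝ := ∑ v, G.μ u v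

/-- Marginal distribution on second-player questions. -/
def μR (v : G.V) : ℝ := ∑ u, G.μ u v

/-- Conditional distribution `μ(v|u)`. -/
def μc (u : G.U) (v : G.V) : ℝ := G.μ u v / G.μL u

/-- A `d`-dimensional quantum strategy for the first player. -/
def IsStrategyA {d : ℕ} (A : G.U → G.A → Mat d) : Prop := ∀ u, IsPOVM (A u)

/-- A `d`-dimensional quantum strategy for the second player. -/
def IsStrategyB {d : ℕ} (B : G.V → G.B → Mat d) : Prop := ∀ v, IsPOVM (B v)

/-- Success probability of a pair of quantum strategies with shared state `ψ`. -/
def pay {d : ℕ} (A : G.U → G.A → Mat d) (B : G.V → G.B → Mat d)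
    (ψ : Fin d × Fin d → ℂ) : ℝ :=
  ∑ u, ∑ v, G.μ u v * ∑ a, ∑ b,
    if G.proj u v b = some a then (braket ψ (mconj (A u a) ⊗ₖ B v b)).re else 0

/-- The entangled value `val*(G)`. -/
noncomputable def entVal : ℝ :=
  sSup { x | ∃ (d : ℕ) (A : G.U → G.A → Mat d) (B : G.V → G.B → Mat d)
    (ψ : Fin d × Fin d → ℂ),
    G.IsStrategyA A ∧ G.IsStrategyB B ∧ enormSq ψ = 1 ∧ x = G.pay A B ψ }

/-- The operator `B_u^a = Σ_v μ(v|u) Σ_{b → a} B_v^b`. -/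
def Bop {d : ℕ} (B : G.V → G.B → Mat d) (u : G.U) (a : G.A) : Mat d :=
  ∑ v, ∑ b, if G.proj u v b = some a then (G.μc u v : ℂ) • B v b else 0

/-- The matrix `Σ_u μ(u) Σ_a conj(B_u^a) ⊗ B_u^a`. -/
def sqMat {d : ℕ} (B : G.V → G.B → Mat d) :
    Matrix (Fin d × Fin d) (Fin d × Fin d) ℂ :=
  ∑ u, (G.μL u : ℂ) • ∑ a, mconj (G.Bop B u a) ⊗ₖ G.Bop B u a

/-- The square norm `‖G‖*`. -/
noncomputable def sqNorm : ℝ :=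
  sSup { x | ∃ (d : ℕ) (B : G.V → G.B → Mat d), G.IsStrategyB B ∧
    x = Real.sqrt (opNorm (G.sqMat B)) }

/-- A vector quantum strategy over the finite measured space `Fin n`. -/
def IsVecStrategy {n d : ℕ} (A : Fin n → G.V → G.B → Mat d) : Prop :=
  ∀ i v, (∀ b, (A i v b).PosSemidef) ∧ ((1 : Mat d) - ∑ b, A i v b).PosSemidef

/-- The matrix `E_ω conj(A_{ωv}) ⊗ A_{ωv}` at a fixed `v`. -/
def vecMatAt {n d : ℕ} (w : Fin n → ℝ) (A : Fin n → G.V → G.B → Mat d) (v : G.V) :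
    Matrix (Fin d × Fin d) (Fin d × Fin d) ℂ :=
  ∑ i, (w i : ℂ) • (mconj (∑ b, A i v b) ⊗ₖ (∑ b, A i v b))

/-- The matrix appearing in the definition of `val₊*`. -/
def vecMat {n d : ℕ} (w : Fin n → ℝ) (A : Fin n → G.V → G.B → Mat d) :
    Matrix (Fin d × Fin d) (Fin d × Fin d) ℂ :=
  ∑ i, (w i : ℂ) • ∑ u, (G.μL u : ℂ) • ∑ a, ∑ v, ∑ v',
    ((G.μc u v * G.μc u v' : ℝ) : ℂ) • ∑ b, ∑ b',
      if G.proj u v b = some a ∧ G.proj u v' b' = some a then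
        mconj (A i v b) ⊗ₖ A i v' b' else 0

/-- The relaxed value `val₊*(G)`. -/
noncomputable def valPlus : ℝ :=
  sSup { x | ∃ (n d : ℕ) (w : Fin n → ℝ) (A : Fin n → G.V → G.B → Mat d),
    (∀ i, 0 < w i) ∧ G.IsVecStrategy A ∧
    (∀ v, Real.sqrt (opNorm (G.vecMatAt w A v)) ≤ 1) ∧
    x = opNorm (G.vecMat w A) }

/-- The product of two projection games. -/
def prod (H : ProjGame) : ProjGame where
  U := G.U × H.U
  V := G.V × H.V
  A := G.A × H.A
  B := G.B × H.B
  fU := inferInstance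
  fV := inferInstance
  fA := inferInstance
  fB := inferInstance
  dA := inferInstance
  μ := fun p q => G.μ p.1 q.1 * H.μ p.2 q.2
  μ_nonneg := fun p q => mul_nonneg (G.μ_nonneg _ _) (H.μ_nonneg _ _)
  μ_sum := by
    have h1 := G.μ_sum
    have h2 := H.μ_sum
    calc ∑ p : G.U × H.U, ∑ q : G.V × H.V, G.μ p.1 q.1 * H.μ p.2 q.2
        = ∑ p : G.U × H.U, (∑ v, G.μ p.1 v) * (∑ v', H.μ p.2 v') := by
          refine Finset.sum_congr rfl fun p _ => ?_
          rw [Fintype.sum_prod_type, Finset.sum_mul_sum]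
      _ = (∑ u, ∑ v, G.μ u v) * (∑ u', ∑ v', H.μ u' v') := by
          rw [Fintype.sum_prod_type, Finset.sum_mul_sum]
      _ = 1 := by rw [h1, h2, one_mul]
  proj := fun p q b =>
    (G.proj p.1 q.1 b.1).bind fun a => (H.proj p.2 q.2 b.2).map fun a' => (a, a')

/-- The `k`-fold repetition `G^{⊗k}` (junk value `G` at `k = 0`). -/
def pow : ℕ → ProjGame
  | 0 => G
  | 1 => G
  | (n+2) => G.prod (pow (n+1))

/-- The normalized Laplacian of the square of the constraint graph of `G`. -/
def lap [DecidableEq G.V] : Matrix G.V G.V ℝ :=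
  1 - Matrix.of fun v v' =>
    (Real.sqrt (G.μR v))⁻¹ * (∑ u, G.μL u * G.μc u v * G.μc u v') * (Real.sqrt (G.μR v'))⁻¹

end ProjGame

/-! ### Sums of matrices over the fibers of a partial map -/

section Fiber

variable {n α β : Type*} [Fintype β] [DecidableEq α]

/-- The matrix `∑_{b : π b = a} K b`. -/
def fiber {M : Type*} [AddCommMonoid M] (π : β → Option α) (K : β → M) (a : α) :
    M :=
  ∑ b, if π b = some a then K b else 0

lemma fiber_map {M N : Type*} [AddCommMonoid M] [AddCommMonoid N] (f : M →+ N)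
    (π : β → Option α) (K : β → M) (a : α) :
    f (fiber π K a) = fiber π (fun b => f (K b)) a := by
  simp only [fiber, map_sum]
  refine Finset.sum_congr rfl fun b _ => ?_
  split_ifs <;> simp

lemma fiber_posSemidef {Q : β → Matrix n n ℂ} (hQ : ∀ b, (Q b).PosSemidef) (π : β → Option α)
    (a : α) : (fiber π Q a).PosSemidef := by
  refine posSemidef_sum _ fun b _ => ?_
  split_ifs
  exacts [hQ b, PosSemidef.zero]

lemma sum_sub_fiber_posSemidef [Fintype α] {Q : β → Matrix n n ℂ} (hQ : ∀ b, (Q b).PosSemidef)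
    (π : β → Option α) : (∑ b, Q b - ∑ a, fiber π Q a).PosSemidef := by
  have e : ∑ b, Q b - ∑ a, fiber π Q a = ∑ b, if π b = none then Q b else 0 := by
    simp only [fiber]
    rw [Finset.sum_comm, ← Finset.sum_sub_distrib]
    refine Finset.sum_congr rfl fun b _ => ?_
    rcases h : π b with _ | a <;> simp
  rw [e]
  refine posSemidef_sum _ fun b _ => ?_
  split_ifs
  exacts [hQ b, PosSemidef.zero]

end Fiber

lemma posSemidef_sub_of_fintype_sum {n α : Type*} [Fintype α] {Q : α → Matrix n n ℂ}
    {X : Matrix n n ℂ}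
    (hQ : ∀ a, (Q a).PosSemidef) (h : (X - ∑ a, Q a).PosSemidef) (a : α) :
    (X - Q a).PosSemidef := by
  classical
  have e : X - Q a = (X - ∑ a, Q a) + ∑ b ∈ Finset.univ.erase a, Q b := by
    rw [← Finset.add_sum_erase _ _ (Finset.mem_univ a)]; abel
  rw [e]
  exact h.add (posSemidef_sum _ fun b _ => hQ b)

/-! ### The real Frobenius inner product -/

section Frobenius

variable {m n l : Type*} [Fintype m] [Fintype n] [Fintype l]

/-- The real part of the Frobenius inner product, as a real bilinear form. -/
def fip : Matrix m n ℂ →ₗ[ℝ] Matrix m n ℂ →ₗ[ℝ] ℝ :=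
  LinearMap.mk₂ ℝ (fun M N => ((Mᴴ * N).trace).re)
    (fun _ _ _ => by simp [Matrix.add_mul]) (fun _ _ _ => by simp)
    (fun _ _ _ => by simp [Matrix.mul_add]) (fun _ _ _ => by simp)

/-- The squared Frobenius norm. -/
def fsq (M : Matrix m n ℂ) : ℝ := fip M M

lemma fip_def (M N : Matrix m n ℂ) : fip M N = ((Mᴴ * N).trace).re := rfl

lemma fip_eq_sum (M N : Matrix m n ℂ) :
    fip M N = ∑ i, ∑ j, (star (M i j) * N i j).re := by
  rw [fip_def, Matrix.trace, Complex.re_sum, Finset.sum_comm]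
  refine Finset.sum_congr rfl fun j _ => ?_
  simp [Matrix.mul_apply]

lemma fsq_eq_sum (M : Matrix m n ℂ) : fsq M = ∑ i, ∑ j, Complex.normSq (M i j) := by
  rw [fsq, fip_eq_sum]
  refine Finset.sum_congr rfl fun i _ => Finset.sum_congr rfl fun j _ => ?_
  simp [Complex.normSq_apply]

lemma fip_comm (M N : Matrix m n ℂ) : fip M N = fip N M := by
  simp only [fip_eq_sum]
  refine Finset.sum_congr rfl fun i _ => Finset.sum_congr rfl fun j _ => ?_
  simp; ring

lemma fsq_nonneg (M : Matrix m n ℂ) : 0 ≤ fsq M := by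
  rw [fsq_eq_sum]
  exact Finset.sum_nonneg fun i _ => Finset.sum_nonneg fun j _ => Complex.normSq_nonneg _

lemma eq_zero_of_fsq_eq_zero {M : Matrix m n ℂ} (h : fsq M = 0) : M = 0 := by
  rw [fsq_eq_sum] at h
  have h1 := (Finset.sum_eq_zero_iff_of_nonneg fun i _ =>
    Finset.sum_nonneg fun j _ => Complex.normSq_nonneg (M i j)).1 h
  ext i j
  have h2 := (Finset.sum_eq_zero_iff_of_nonneg fun j _ =>
    Complex.normSq_nonneg (M i j)).1 (h1 i (Finset.mem_univ _)) j (Finset.mem_univ _)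
  simpa using h2

lemma fsq_smul (c : ℝ) (M : Matrix m n ℂ) : fsq (c • M) = c ^ 2 * fsq M := by
  simp [fsq]; ring

lemma fsq_sub (M N : Matrix m n ℂ) : fsq (M - N) = fsq M - 2 * fip M N + fsq N := by
  simp only [fsq, map_sub, LinearMap.sub_apply, fip_comm N M]; ring

lemma fsq_add (M N : Matrix m n ℂ) : fsq (M + N) = fsq M + 2 * fip M N + fsq N := by
  simp only [fsq, map_add, LinearMap.add_apply, fip_comm N M]; ring

lemma two_mul_fip_le (M N : Matrix m n ℂ) : 2 * fip M N ≤ fsq M + fsq N := by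
  have := fsq_nonneg (M - N)
  rw [fsq_sub] at this; linarith

/-- Weighted arithmetic-geometric mean inequality for the Frobenius inner product. -/
lemma fip_le {s : ℝ} (hs : 0 < s) (M N : Matrix m n ℂ) :
    fip M N ≤ fsq M / (2 * s) + s / 2 * fsq N := by
  have h := fsq_nonneg (M - s • N)
  rw [fsq_sub, fsq_smul, map_smul, smul_eq_mul] at h
  have e : fsq M / (2 * s) + s / 2 * fsq N = (fsq M + s ^ 2 * fsq N) / (2 * s) := by
    field_simp
  rw [e, le_div_iff₀ (by positivity)]
  linarith

lemma neg_fip_le {s : ℝ} (hs : 0 < s) (M N : Matrix m n ℂ) :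
    -fip M N ≤ fsq M / (2 * s) + s / 2 * fsq N := by
  have h := fip_le hs (-M) N
  have e : fsq (-M) = fsq M := by simp [fsq]
  rw [e] at h
  simpa using h

lemma fip_mul_left (A : Matrix m l ℂ) (M : Matrix l n ℂ) (N : Matrix m n ℂ) :
    fip (A * M) N = fip M (Aᴴ * N) := by
  simp only [fip_def, conjTranspose_mul, Matrix.mul_assoc]

lemma fip_mul_right (A : Matrix l n ℂ) (M : Matrix m l ℂ) (N : Matrix m n ℂ) :
    fip (M * A) N = fip M (N * Aᴴ) := by
  simp only [fip_def, conjTranspose_mul]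
  rw [Matrix.mul_assoc, Matrix.trace_mul_comm, Matrix.mul_assoc]

lemma fip_mul_left' {A : Matrix m m ℂ} (hA : A.IsHermitian) (M N : Matrix m n ℂ) :
    fip (A * M) N = fip M (A * N) := by
  rw [fip_mul_left, hA.eq]

lemma fip_mul_right' {A : Matrix n n ℂ} (hA : A.IsHermitian) (M N : Matrix m n ℂ) :
    fip (M * A) N = fip M (N * A) := by
  rw [fip_mul_right, hA.eq]

/-- Two positive semidefinite matrices have nonnegative inner product. -/
lemma fip_nonneg {M N : Matrix n n ℂ} (hM : M.PosSemidef) (hN : N.PosSemidef) :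
    0 ≤ fip M N := by
  classical
  obtain ⟨B, rfl⟩ : ∃ B : Matrix n n ℂ, M = Bᴴ * B := by
    open scoped MatrixOrder in
    have := CStarAlgebra.nonneg_iff_eq_star_mul_self.mp hM.nonneg
    simpa [Matrix.star_eq_conjTranspose] using this
  have h := (hN.mul_mul_conjTranspose_same B).trace_nonneg
  rw [fip_def, conjTranspose_mul, conjTranspose_conjTranspose, Matrix.mul_assoc,
    Matrix.trace_mul_comm]
  exact (Complex.le_def.1 h).1

lemma fip_le_fip {M M' N N' : Matrix n n ℂ} (hM : M.PosSemidef) (hN' : N'.PosSemidef)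
    (hMM : (M' - M).PosSemidef) (hNN : (N' - N).PosSemidef) : fip M N ≤ fip M' N' := by
  have h1 := fip_nonneg hM hNN
  have h2 := fip_nonneg hMM hN'
  simp only [map_sub, LinearMap.sub_apply] at h1 h2
  linarith

/-- Matching sums of inner products are bounded by the inner product of the totals. -/
lemma sum_fip_le {α : Type*} [Fintype α] {X Y : α → Matrix n n ℂ} {X' Y' : Matrix n n ℂ}
    (hX : ∀ a, (X a).PosSemidef) (hY : ∀ a, (Y a).PosSemidef)
    (hX' : (X' - ∑ a, X a).PosSemidef) (hY' : (Y' - ∑ a, Y a).PosSemidef) :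
    ∑ a, fip (X a) (Y a) ≤ fip X' Y' := by
  classical
  have hS : (∑ a, X a).PosSemidef := posSemidef_sum _ fun a _ => hX a
  have hY'' : Y'.PosSemidef := by
    have := hY'.add (posSemidef_sum Finset.univ fun a _ => hY a)
    simpa using this
  calc ∑ a, fip (X a) (Y a) ≤ ∑ a, fip (X a) Y' := by
        refine Finset.sum_le_sum fun a _ => ?_
        have := fip_nonneg (hX a) (posSemidef_sub_of_fintype_sum hY hY' a)
        rw [map_sub] at this; linarith
    _ = fip (∑ a, X a) Y' := by simp
    _ ≤ fip X' Y' := fip_le_fip hS hY'' hX' (by simpa using PosSemidef.zero)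

lemma fsq_mul_unitary_left [DecidableEq m] {U : Matrix m m ℂ} (hU : Uᴴ * U = 1)
    (M : Matrix m n ℂ) : fsq (U * M) = fsq M := by
  rw [fsq, fip_mul_left, ← Matrix.mul_assoc, hU, Matrix.one_mul, fsq]

lemma fsq_mul_unitary_right [DecidableEq n] {U : Matrix n n ℂ} (hU : U * Uᴴ = 1)
    (M : Matrix m n ℂ) : fsq (M * U) = fsq M := by
  rw [fsq, fip_mul_right, Matrix.mul_assoc, hU, Matrix.mul_one, fsq]

end Frobenius

/-! ### Sub-POVMs -/

section SubPOVM

variable {n l α β : Type*} [Fintype n] [DecidableEq n] [Fintype α] [Fintype β] [Fintype l]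

/-- A family of positive semidefinite matrices with sum at most the identity. -/
def IsSubPOVM (Q : α → Matrix n n ℂ) : Prop :=
  (∀ a, (Q a).PosSemidef) ∧ (1 - ∑ a, Q a).PosSemidef

lemma IsSubPOVM.fsq_mul_le {Q : α → Matrix n n ℂ} (hQ : IsSubPOVM Q) (X : Matrix n l ℂ) :
    ∑ a, fsq (Q a * X) ≤ fsq X := by
  have h1 : ∀ a, fsq (Q a * X) ≤ fip (X * Xᴴ) (Q a) := by
    intro a
    have hq := hQ.1 a
    have hq' := posSemidef_sub_of_fintype_sum hQ.1 hQ.2 a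
    have e : Q a - Q a * Q a = (Q a)ᴴ * (1 - Q a) * Q a + (1 - Q a)ᴴ * Q a * (1 - Q a) := by
      rw [hq.1.eq, hq'.1.eq]; noncomm_ring
    have hp : (Q a - Q a * Q a).PosSemidef := by
      rw [e]
      exact (hq'.conjTranspose_mul_mul_same _).add (hq.conjTranspose_mul_mul_same _)
    have h := fip_nonneg (posSemidef_self_mul_conjTranspose X) hp
    have e2 : fsq (Q a * X) = fip (X * Xᴴ) (Q a * Q a) := by
      rw [fsq, fip_mul_left' hq.1, fip_mul_right, conjTranspose_conjTranspose, fip_comm,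
        ← Matrix.mul_assoc, fip_comm]
    rw [map_sub, ← e2] at h
    linarith
  calc ∑ a, fsq (Q a * X) ≤ ∑ a, fip (X * Xᴴ) (Q a) := Finset.sum_le_sum fun a _ => h1 a
    _ = fip (X * Xᴴ) (∑ a, Q a) := by simp
    _ ≤ fip (X * Xᴴ) 1 := by
        have h := fip_nonneg (posSemidef_self_mul_conjTranspose X) hQ.2
        rw [map_sub] at h; linarith
    _ = fsq X := by
        rw [fsq, fip_mul_right, conjTranspose_conjTranspose, Matrix.one_mul]

variable [DecidableEq α]

omit [Fintype n] in
lemma IsSubPOVM.fiber {Q : β → Matrix n n ℂ} (hQ : IsSubPOVM Q) (π : β → Option α) :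
    IsSubPOVM (_root_.fiber π Q) := by
  refine ⟨fiber_posSemidef hQ.1 π, ?_⟩
  have := hQ.2.add (sum_sub_fiber_posSemidef hQ.1 π)
  simpa using this

omit [DecidableEq n] in
lemma sum_fip_fiber_le {K L : β → Matrix n n ℂ} (hK : ∀ b, (K b).PosSemidef)
    (hL : ∀ b, (L b).PosSemidef) (π π' : β → Option α) :
    ∑ a, fip (fiber π K a) (fiber π' L a) ≤ fip (∑ b, K b) (∑ b, L b) :=
  sum_fip_le (fiber_posSemidef hK π) (fiber_posSemidef hL π')
    (sum_sub_fiber_posSemidef hK π) (sum_sub_fiber_posSemidef hL π')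

end SubPOVM

/-! ### Block-diagonal families -/

section Block

variable {n o : Type*} [Fintype n] [Fintype o] [DecidableEq o]

lemma fip_blockDiagonal (M N : o → Matrix n n ℂ) :
    fip (blockDiagonal M) (blockDiagonal N) = ∑ k, fip (M k) (N k) := by
  rw [fip_def, blockDiagonal_conjTranspose, ← blockDiagonal_mul, trace_blockDiagonal,
    Complex.re_sum]
  rfl

lemma blockDiagonal_posSemidef {M : o → Matrix n n ℂ} (hM : ∀ k, (M k).PosSemidef) :
    (blockDiagonal M).PosSemidef := by
  classical
  choose B hB using fun k => (show ∃ B : Matrix n n ℂ, M k = Bᴴ * B by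
    open scoped MatrixOrder in
    have := CStarAlgebra.nonneg_iff_eq_star_mul_self.mp (hM k).nonneg
    simpa [Matrix.star_eq_conjTranspose] using this)
  have e : blockDiagonal M = (blockDiagonal B)ᴴ * blockDiagonal B := by
    rw [blockDiagonal_conjTranspose, ← blockDiagonal_mul]
    exact congrArg _ (funext hB)
  rw [e]
  exact posSemidef_conjTranspose_mul_self _

end Block

/-! ### Functions of a diagonalised matrix -/

section ConjDiag

variable {n : Type*} [Fintype n] [DecidableEq n]

/-- The matrix `U diag(f) Uᴴ`. -/
def conjDiag (U : Matrix n n ℂ) (f : n → ℝ) : Matrix n n ℂ :=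
  U * diagonal (fun i => (f i : ℂ)) * Uᴴ

lemma conjDiag_isHermitian (U : Matrix n n ℂ) (f : n → ℝ) : (conjDiag U f).IsHermitian := by
  have h : (diagonal (fun i => (f i : ℂ))).IsHermitian := by
    rw [Matrix.IsHermitian, diagonal_conjTranspose]
    congr 1; ext i; simp
  exact isHermitian_mul_mul_conjTranspose U h

lemma conjDiag_posSemidef (U : Matrix n n ℂ) {f : n → ℝ} (hf : ∀ i, 0 ≤ f i) :
    (conjDiag U f).PosSemidef := by
  refine PosSemidef.mul_mul_conjTranspose_same (PosSemidef.diagonal fun i => ?_) U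
  simpa using hf i

lemma conjDiag_mul {U : Matrix n n ℂ} (hU : Uᴴ * U = 1) (f g : n → ℝ) :
    conjDiag U f * conjDiag U g = conjDiag U (fun i => f i * g i) := by
  calc conjDiag U f * conjDiag U g
      = U * diagonal (fun i => (f i : ℂ)) * (Uᴴ * U) * diagonal (fun i => (g i : ℂ)) * Uᴴ := by
        simp only [conjDiag, Matrix.mul_assoc]
    _ = _ := by
        rw [hU, Matrix.mul_one, Matrix.mul_assoc U, diagonal_mul_diagonal, conjDiag]
        simp

lemma conjDiag_sub (U : Matrix n n ℂ) (f g : n → ℝ) :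
    conjDiag U f - conjDiag U g = conjDiag U (fun i => f i - g i) := by
  simp only [conjDiag]
  rw [← Matrix.sub_mul, ← Matrix.mul_sub, diagonal_sub]
  simp

lemma conjDiag_sum {ι : Type*} (s : Finset ι) (U : Matrix n n ℂ) (f : ι → n → ℝ) :
    ∑ j ∈ s, conjDiag U (f j) = conjDiag U (fun i => ∑ j ∈ s, f j i) := by
  simp only [conjDiag]
  rw [← Finset.sum_mul, ← Finset.mul_sum]
  congr 2
  ext i k
  simp only [Matrix.sum_apply, diagonal_apply]
  split_ifs <;> simp

lemma conjDiag_smul (U : Matrix n n ℂ) (c : ℝ) (f : n → ℝ) :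
    c • conjDiag U f = conjDiag U (fun i => c * f i) := by
  simp only [conjDiag]
  rw [← Matrix.smul_mul, ← Matrix.mul_smul]
  congr 2
  ext i k
  simp only [Matrix.smul_apply, diagonal_apply]
  split_ifs <;> simp

lemma conjDiag_one {U : Matrix n n ℂ} (hU : Uᴴ * U = 1) : conjDiag U (fun _ => 1) = 1 := by
  simp [conjDiag, mul_eq_one_comm.1 hU]

lemma conjDiag_zero (U : Matrix n n ℂ) : conjDiag U (fun _ => 0) = 0 := by
  simp [conjDiag]

/-- Frobenius norm of a difference of two-sided products, in a pair of eigenbases. -/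
lemma fsq_conjDiag_sub {U V : Matrix n n ℂ} (hU : Uᴴ * U = 1) (hV : Vᴴ * V = 1)
    (X : Matrix n n ℂ) (f₁ g₁ f₂ g₂ : n → ℝ) :
    fsq (conjDiag U f₁ * X * conjDiag V g₁ - conjDiag U f₂ * X * conjDiag V g₂) =
      ∑ k, ∑ l, (f₁ k * g₁ l - f₂ k * g₂ l) ^ 2 * Complex.normSq ((Uᴴ * X * V) k l) := by
  have e : conjDiag U f₁ * X * conjDiag V g₁ - conjDiag U f₂ * X * conjDiag V g₂ =
      U * (diagonal (fun i => (f₁ i : ℂ)) * (Uᴴ * X * V) * diagonal (fun i => (g₁ i : ℂ)) -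
        diagonal (fun i => (f₂ i : ℂ)) * (Uᴴ * X * V) * diagonal (fun i => (g₂ i : ℂ))) * Vᴴ := by
    simp only [conjDiag, Matrix.mul_sub, Matrix.sub_mul, Matrix.mul_assoc]
  rw [e, fsq_mul_unitary_right (by simpa using hV), fsq_mul_unitary_left hU, fsq_eq_sum]
  refine Finset.sum_congr rfl fun k _ => Finset.sum_congr rfl fun l _ => ?_
  rw [Matrix.sub_apply, mul_diagonal, mul_diagonal, diagonal_mul, diagonal_mul]
  have : (f₁ k : ℂ) * (Uᴴ * X * V) k l * (g₁ l) - (f₂ k) * (Uᴴ * X * V) k l * (g₂ l)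
      = ((f₁ k * g₁ l - f₂ k * g₂ l : ℝ) : ℂ) * (Uᴴ * X * V) k l := by
    push_cast; ring
  rw [this, Complex.normSq_mul, Complex.normSq_ofReal]
  ring

lemma fsq_conjDiag {U : Matrix n n ℂ} (hU : Uᴴ * U = 1) (f : n → ℝ) :
    fsq (conjDiag U f) = ∑ i, f i ^ 2 := by
  rw [conjDiag, fsq_mul_unitary_right (by simpa using hU), fsq_mul_unitary_left hU, fsq_eq_sum]
  refine Finset.sum_congr rfl fun i _ => ?_
  rw [Finset.sum_eq_single i]
  · simp [Complex.normSq_ofReal, sq]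
  · intro j _ hj; simp [diagonal_apply_ne _ hj.symm]
  · simp

/-- A positive semidefinite matrix in its eigenbasis. -/
lemma exists_eq_conjDiag {K : Matrix n n ℂ} (hK : K.PosSemidef) :
    ∃ (U : Matrix n n ℂ) (x : n → ℝ), Uᴴ * U = 1 ∧ (∀ i, 0 ≤ x i) ∧ K = conjDiag U x := by
  refine ⟨hK.1.eigenvectorUnitary, hK.1.eigenvalues, ?_, hK.eigenvalues_nonneg, ?_⟩
  · exact Unitary.coe_star_mul_self hK.1.eigenvectorUnitary
  · conv_lhs => rw [hK.1.spectral_theorem, Unitary.conjStarAlgAut_apply]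
    rfl

end ConjDiag

/-! ### Spectral thresholds -/

/-- The indicator of `x² ≥ (j + 1) / m`. -/
def thr (m : ℕ) (j : Fin m) (x : ℝ) : ℝ := if ((j : ℕ) + 1 : ℝ) ≤ m * x ^ 2 then 1 else 0

lemma thr_mul_self (m : ℕ) (j : Fin m) (x : ℝ) : thr m j x * thr m j x = thr m j x := by
  unfold thr; split_ifs <;> simp

lemma sum_thr {m : ℕ} {x : ℝ} (hx : x ^ 2 ≤ 1) : ∑ j, thr m j x = ⌊m * x ^ 2⌋₊ := by
  have hfl : ⌊m * x ^ 2⌋₊ ≤ m := by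
    have h : (m : ℝ) * x ^ 2 ≤ m := by nlinarith [(Nat.cast_nonneg m : (0 : ℝ) ≤ m)]
    exact (Nat.floor_mono h).trans (Nat.floor_natCast m).le
  simp only [thr]
  rw [Fin.sum_univ_eq_sum_range
    (fun j : ℕ => if ((j : ℝ) + 1) ≤ m * x ^ 2 then (1 : ℝ) else 0) m, Finset.sum_boole]
  congr 1
  have : (Finset.range m).filter (fun j : ℕ => ((j : ℝ) + 1) ≤ m * x ^ 2) =
      Finset.range ⌊m * x ^ 2⌋₊ := by
    ext j
    simp only [Finset.mem_filter, Finset.mem_range]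
    have h : ((j : ℝ) + 1 ≤ m * x ^ 2) ↔ j < ⌊m * x ^ 2⌋₊ := by
      rw [← Nat.succ_le_iff, Nat.le_floor_iff (by positivity)]; push_cast; rfl
    rw [h]; omega
  rw [this, Finset.card_range]

lemma sum_thr_le {m : ℕ} {x : ℝ} (hx : x ^ 2 ≤ 1) : ∑ j, thr m j x ≤ m * x ^ 2 := by
  rw [sum_thr hx]; exact Nat.floor_le (by positivity)

lemma le_sum_thr {m : ℕ} {x : ℝ} (hx : x ^ 2 ≤ 1) : m * x ^ 2 - 1 ≤ ∑ j, thr m j x := by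
  rw [sum_thr hx]; linarith [Nat.lt_floor_add_one (m * x ^ 2)]

lemma sum_thr_sub_sq_le {m : ℕ} {x y : ℝ} (hx : x ^ 2 ≤ 1) (hy : y ^ 2 ≤ 1) :
    ∑ j, (thr m j x - thr m j y) ^ 2 ≤ m * |x ^ 2 - y ^ 2| + 1 := by
  wlog h : y ^ 2 ≤ x ^ 2 generalizing x y
  · have := this hy hx (le_of_not_ge h)
    rw [abs_sub_comm] at this
    simpa only [sub_sq_comm (thr m _ y)] using this
  have e : ∀ j, (thr m j x - thr m j y) ^ 2 = thr m j x - thr m j y := by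
    intro j
    have hm : (m : ℝ) * y ^ 2 ≤ m * x ^ 2 := by gcongr
    unfold thr
    split_ifs with h1 h2 h2
    · simp
    · simp
    · exact absurd (h2.trans hm) h1
    · simp
  rw [Finset.sum_congr rfl fun j _ => e j, Finset.sum_sub_distrib, abs_of_nonneg (by linarith)]
  linarith [sum_thr_le (m := m) hx, le_sum_thr (m := m) hy]

lemma abs_sq_sub_sq_le {t : ℝ} (ht : 0 < t) (x y : ℝ) :
    |x ^ 2 - y ^ 2| ≤ ((x - y) ^ 2 / t + t * (x + y) ^ 2) / 2 := by
  have e : x ^ 2 - y ^ 2 = (x - y) * (x + y) := by ring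
  rw [e, abs_mul, ← sq_abs (x - y), ← sq_abs (x + y)]
  set a := |x - y|
  set b := |x + y|
  have : a ^ 2 / t + t * b ^ 2 - 2 * (a * b) = (a - t * b) ^ 2 / t := by field_simp; ring
  have h : 0 ≤ (a - t * b) ^ 2 / t := by positivity
  linarith

lemma sum_thr_sub_sq_le' {m : ℕ} {t x y : ℝ} (ht : 0 < t) (hx : x ^ 2 ≤ 1) (hy : y ^ 2 ≤ 1) :
    ∑ j, (thr m j x - thr m j y) ^ 2 ≤
      m / (2 * t) * (x - y) ^ 2 + m * t / 2 * (x + y) ^ 2 + 1 := by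
  have h1 := sum_thr_sub_sq_le (m := m) hx hy
  have h2 := mul_le_mul_of_nonneg_left (abs_sq_sub_sq_le ht x y) (Nat.cast_nonneg (α := ℝ) m)
  have e : (m : ℝ) * (((x - y) ^ 2 / t + t * (x + y) ^ 2) / 2) =
      m / (2 * t) * (x - y) ^ 2 + m * t / 2 * (x + y) ^ 2 := by field_simp
  linarith

lemma sq_le_one_of_sum_sq {n : Type*} [Fintype n] {x : n → ℝ} (h : ∑ i, x i ^ 2 ≤ 1) (i : n) :
    x i ^ 2 ≤ 1 :=
  (Finset.single_le_sum (f := fun i => x i ^ 2) (fun _ _ => sq_nonneg _)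
    (Finset.mem_univ i)).trans h

/-! ### Approximate commutation -/

section Commutation

variable {n α : Type*} [Fintype n] [DecidableEq n] [Fintype α]
  {U V : Matrix n n ℂ} {x y : n → ℝ} {Q : α → Matrix n n ℂ} {ε t : ℝ} {m : ℕ}

/-- The squared entries of a sub-POVM in the eigenbasis `U`. -/
def entrySq (U : Matrix n n ℂ) (Q : α → Matrix n n ℂ) (k l : n) : ℝ :=
  ∑ a, Complex.normSq ((Uᴴ * Q a * U) k l)

lemma sum_fsq_conjDiag_sub (hU : Uᴴ * U = 1) (Q : α → Matrix n n ℂ) (f₁ g₁ f₂ g₂ : n → ℝ) :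
    ∑ a, fsq (conjDiag U f₁ * Q a * conjDiag U g₁ - conjDiag U f₂ * Q a * conjDiag U g₂) =
      ∑ k, ∑ l, (f₁ k * g₁ l - f₂ k * g₂ l) ^ 2 * entrySq U Q k l := by
  simp only [fsq_conjDiag_sub hU hU, entrySq, Finset.mul_sum]
  rw [Finset.sum_comm]
  exact Finset.sum_congr rfl fun k _ => Finset.sum_comm

omit [DecidableEq n] in
lemma entrySq_nonneg (k l : n) : 0 ≤ entrySq U Q k l :=
  Finset.sum_nonneg fun _ _ => Complex.normSq_nonneg _

lemma entrySq_comm (hQ : IsSubPOVM Q) (k l : n) : entrySq U Q k l = entrySq U Q l k := by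
  refine Finset.sum_congr rfl fun a _ => ?_
  have h : (Uᴴ * Q a * U).IsHermitian := isHermitian_conjTranspose_mul_mul U (hQ.1 a).1
  rw [← h.apply, ← Complex.normSq_conj]
  simp

lemma sum_entrySq_mul_sq_le (hU : Uᴴ * U = 1) (hQ : IsSubPOVM Q) (f : n → ℝ) :
    ∑ k, ∑ l, f l ^ 2 * entrySq U Q k l ≤ ∑ i, f i ^ 2 := by
  have h := hQ.fsq_mul_le (conjDiag U f)
  have e := sum_fsq_conjDiag_sub hU Q (fun _ => 1) f (fun _ => 0) (fun _ => 0)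
  simp only [conjDiag_one hU, conjDiag_zero, Matrix.zero_mul, sub_zero, one_mul, mul_zero] at e
  rw [← e, ← fsq_conjDiag hU]
  exact h

lemma sum_entrySq_mul_sq_le' (hU : Uᴴ * U = 1) (hQ : IsSubPOVM Q) (f : n → ℝ) :
    ∑ k, ∑ l, f k ^ 2 * entrySq U Q k l ≤ ∑ i, f i ^ 2 := by
  rw [Finset.sum_comm]
  simpa only [entrySq_comm hQ] using sum_entrySq_mul_sq_le hU hQ f

lemma sum_entrySq_le (hU : Uᴴ * U = 1) (hQ : IsSubPOVM Q) :
    ∑ k, ∑ l, entrySq U Q k l ≤ Fintype.card n := by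
  simpa using sum_entrySq_mul_sq_le hU hQ (fun _ => 1)

lemma sum_fsq_sqrt_mul_mul (hU : Uᴴ * U = 1) (hx : ∀ i, 0 ≤ x i) :
    ∑ a, fsq (conjDiag U (fun i => √(x i)) * Q a * conjDiag U (fun i => √(x i))) =
      ∑ k, ∑ l, x k * x l * entrySq U Q k l := by
  have e := sum_fsq_conjDiag_sub hU Q (fun i => √(x i)) (fun i => √(x i)) (fun _ => 0) (fun _ => 0)
  simp only [conjDiag_zero, Matrix.zero_mul, sub_zero, mul_zero, mul_pow,
    Real.sq_sqrt (hx _)] at e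
  exact e

lemma sum_fsq_sqrt_mul_mul_le (hU : Uᴴ * U = 1) (hx : ∀ i, 0 ≤ x i) (hQ : IsSubPOVM Q) :
    ∑ a, fsq (conjDiag U (fun i => √(x i)) * Q a * conjDiag U (fun i => √(x i))) ≤
      ∑ i, x i ^ 2 := by
  rw [sum_fsq_sqrt_mul_mul hU hx]
  have h1 := sum_entrySq_mul_sq_le hU hQ x
  have h2 := sum_entrySq_mul_sq_le' hU hQ x
  have h3 : ∑ k, ∑ l, x k * x l * entrySq U Q k l ≤
      ∑ k, ∑ l, (x k ^ 2 * entrySq U Q k l + x l ^ 2 * entrySq U Q k l) / 2 := by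
    refine Finset.sum_le_sum fun k _ => Finset.sum_le_sum fun l _ => ?_
    nlinarith [mul_nonneg (sq_nonneg (x k - x l)) (entrySq_nonneg (U := U) (Q := Q) k l)]
  simp only [← Finset.sum_div, Finset.sum_add_distrib] at h3
  linarith

lemma sum_entrySq_mul_sub_sq_le (hU : Uᴴ * U = 1) (hx : ∀ i, 0 ≤ x i) (hx1 : ∑ i, x i ^ 2 ≤ 1)
    (hQ : IsSubPOVM Q)
    (hε : 1 - 2 * ε ≤
      ∑ a, fsq (conjDiag U (fun i => √(x i)) * Q a * conjDiag U (fun i => √(x i)))) :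
    ∑ k, ∑ l, (x k - x l) ^ 2 * entrySq U Q k l ≤ 4 * ε := by
  rw [sum_fsq_sqrt_mul_mul hU hx] at hε
  have h1 := sum_entrySq_mul_sq_le hU hQ x
  have h2 := sum_entrySq_mul_sq_le' hU hQ x
  have e : ∑ k, ∑ l, (x k - x l) ^ 2 * entrySq U Q k l =
      (∑ k, ∑ l, x k ^ 2 * entrySq U Q k l) + (∑ k, ∑ l, x l ^ 2 * entrySq U Q k l) -
        2 * ∑ k, ∑ l, x k * x l * entrySq U Q k l := by
    simp only [Finset.mul_sum, ← Finset.sum_add_distrib, ← Finset.sum_sub_distrib]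
    exact Finset.sum_congr rfl fun k _ => Finset.sum_congr rfl fun l _ => by ring
  linarith

lemma sum_entrySq_mul_add_sq_le (hU : Uᴴ * U = 1) (hx1 : ∑ i, x i ^ 2 ≤ 1)
    (hQ : IsSubPOVM Q) :
    ∑ k, ∑ l, (x k + x l) ^ 2 * entrySq U Q k l ≤ 4 := by
  have h1 := sum_entrySq_mul_sq_le hU hQ x
  have h2 := sum_entrySq_mul_sq_le' hU hQ x
  have e : ∑ k, ∑ l, (x k + x l) ^ 2 * entrySq U Q k l ≤
      2 * (∑ k, ∑ l, x k ^ 2 * entrySq U Q k l) + 2 * (∑ k, ∑ l, x l ^ 2 * entrySq U Q k l) := by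
    simp only [Finset.mul_sum, ← Finset.sum_add_distrib]
    refine Finset.sum_le_sum fun k _ => Finset.sum_le_sum fun l _ => ?_
    nlinarith [mul_nonneg (sq_nonneg (x k - x l)) (entrySq_nonneg (U := U) (Q := Q) k l)]
  linarith

/-- If `∑ ‖K^{1/2} Q K^{1/2}‖²` is almost `1`, then `Q K` is close to `K^{1/2} Q K^{1/2}`. -/
lemma sum_fsq_mul_sub_le (hU : Uᴴ * U = 1) (hx : ∀ i, 0 ≤ x i) (hx1 : ∑ i, x i ^ 2 ≤ 1)
    (hQ : IsSubPOVM Q) (ht : 0 < t)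
    (hε : 1 - 2 * ε ≤
      ∑ a, fsq (conjDiag U (fun i => √(x i)) * Q a * conjDiag U (fun i => √(x i)))) :
    ∑ a, fsq (Q a * conjDiag U x -
      conjDiag U (fun i => √(x i)) * Q a * conjDiag U (fun i => √(x i))) ≤ 2 * ε / t + t / 2 := by
  have h1 := sum_entrySq_mul_sub_sq_le hU hx hx1 hQ hε
  have h2 := (sum_entrySq_mul_sq_le hU hQ x).trans hx1
  have e := sum_fsq_conjDiag_sub hU Q (fun _ => 1) x (fun i => √(x i)) (fun i => √(x i))
  simp only [conjDiag_one hU, Matrix.one_mul] at e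
  rw [e]
  calc _ ≤ ∑ k, ∑ l, (1 / (2 * t) * ((x k - x l) ^ 2 * entrySq U Q k l) +
        t / 2 * (x l ^ 2 * entrySq U Q k l)) := by
        refine Finset.sum_le_sum fun k _ => Finset.sum_le_sum fun l _ => ?_
        have hq := entrySq_nonneg (U := U) (Q := Q) k l
        have : (1 * x l - √(x k) * √(x l)) ^ 2 ≤
            1 / (2 * t) * (x k - x l) ^ 2 + t / 2 * x l ^ 2 := by
          obtain ⟨a, ha, hak⟩ : ∃ a, 0 ≤ a ∧ x k = a ^ 2 :=
            ⟨√(x k), Real.sqrt_nonneg _, (Real.sq_sqrt (hx k)).symm⟩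
          obtain ⟨b, hb, hbl⟩ : ∃ b, 0 ≤ b ∧ x l = b ^ 2 :=
            ⟨√(x l), Real.sqrt_nonneg _, (Real.sq_sqrt (hx l)).symm⟩
          rw [hak, hbl, Real.sqrt_sq ha, Real.sqrt_sq hb]
          have e1 : (1 * b ^ 2 - a * b) ^ 2 = b ^ 2 * (b - a) ^ 2 := by ring
          have e2 : (b - a) ^ 2 ≤ |a ^ 2 - b ^ 2| := by
            have : a ^ 2 - b ^ 2 = (a - b) * (a + b) := by ring
            rw [this, abs_mul, abs_of_nonneg (add_nonneg ha hb)]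
            have h3 : (b - a) ^ 2 = |a - b| * |a - b| := by rw [abs_mul_abs_self]; ring
            rw [h3]
            gcongr
            rw [abs_le]; constructor <;> linarith
          have e3 : b ^ 2 * |a ^ 2 - b ^ 2| ≤
              1 / (2 * t) * (a ^ 2 - b ^ 2) ^ 2 + t / 2 * (b ^ 2) ^ 2 := by
            rw [← sq_abs (a ^ 2 - b ^ 2)]
            set d := |a ^ 2 - b ^ 2|
            have : 1 / (2 * t) * d ^ 2 + t / 2 * (b ^ 2) ^ 2 - b ^ 2 * d =
                (d - t * b ^ 2) ^ 2 / (2 * t) := by field_simp; ring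
            have h4 : 0 ≤ (d - t * b ^ 2) ^ 2 / (2 * t) := by positivity
            linarith
          rw [e1]
          exact (mul_le_mul_of_nonneg_left e2 (sq_nonneg b)).trans e3
        calc _ ≤ _ := mul_le_mul_of_nonneg_right this hq
          _ = _ := by ring
    _ = 1 / (2 * t) * (∑ k, ∑ l, (x k - x l) ^ 2 * entrySq U Q k l) +
        t / 2 * ∑ k, ∑ l, x l ^ 2 * entrySq U Q k l := by
        simp only [Finset.sum_add_distrib, Finset.mul_sum]
    _ ≤ 1 / (2 * t) * (4 * ε) + t / 2 * 1 := by gcongr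
    _ = _ := by field_simp; ring

/-- The spectral thresholds of `K` approximately commute with `Q`. -/
lemma sum_fsq_thr_sub_le (hU : Uᴴ * U = 1) (hx : ∀ i, 0 ≤ x i) (hx1 : ∑ i, x i ^ 2 ≤ 1)
    (hQ : IsSubPOVM Q) (ht : 0 < t)
    (hε : 1 - 2 * ε ≤
      ∑ a, fsq (conjDiag U (fun i => √(x i)) * Q a * conjDiag U (fun i => √(x i)))) :
    ∑ j : Fin m, ∑ a, fsq (Q a * conjDiag U (fun i => thr m j (x i)) -
      conjDiag U (fun i => thr m j (x i)) * Q a * conjDiag U (fun i => thr m j (x i))) ≤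
      m * (2 * ε / t + 2 * t) + Fintype.card n := by
  have h1 := sum_entrySq_mul_sub_sq_le hU hx hx1 hQ hε
  have h2 := sum_entrySq_mul_add_sq_le hU hx1 hQ
  have h3 := sum_entrySq_le hU hQ
  have e := fun j : Fin m => sum_fsq_conjDiag_sub hU Q (fun _ => 1)
    (fun i => thr m j (x i)) (fun i => thr m j (x i)) (fun i => thr m j (x i))
  simp only [conjDiag_one hU, Matrix.one_mul] at e
  simp only [e]
  rw [Finset.sum_comm]
  calc _ = ∑ k, ∑ l, (∑ j, (1 * thr m j (x l) - thr m j (x k) * thr m j (x l)) ^ 2) *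
        entrySq U Q k l := by
        refine Finset.sum_congr rfl fun k _ => ?_
        rw [Finset.sum_comm]
        exact Finset.sum_congr rfl fun l _ => (Finset.sum_mul _ _ _).symm
    _ ≤ ∑ k, ∑ l, (m / (2 * t) * ((x k - x l) ^ 2 * entrySq U Q k l) +
        m * t / 2 * ((x k + x l) ^ 2 * entrySq U Q k l) + entrySq U Q k l) := by
        refine Finset.sum_le_sum fun k _ => Finset.sum_le_sum fun l _ => ?_
        have hq := entrySq_nonneg (U := U) (Q := Q) k l
        have h4 := sum_thr_sub_sq_le' (m := m) ht (sq_le_one_of_sum_sq hx1 k)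
          (sq_le_one_of_sum_sq hx1 l)
        have h5 : ∑ j, (1 * thr m j (x l) - thr m j (x k) * thr m j (x l)) ^ 2 ≤
            ∑ j, (thr m j (x k) - thr m j (x l)) ^ 2 := by
          refine Finset.sum_le_sum fun j _ => ?_
          unfold thr; split_ifs <;> norm_num
        calc _ ≤ _ := mul_le_mul_of_nonneg_right (h5.trans h4) hq
          _ = _ := by ring
    _ = m / (2 * t) * (∑ k, ∑ l, (x k - x l) ^ 2 * entrySq U Q k l) +
        m * t / 2 * (∑ k, ∑ l, (x k + x l) ^ 2 * entrySq U Q k l) +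
        ∑ k, ∑ l, entrySq U Q k l := by
        simp only [Finset.sum_add_distrib, Finset.mul_sum]
    _ ≤ m / (2 * t) * (4 * ε) + m * t / 2 * 4 + Fintype.card n := by gcongr
    _ = _ := by field_simp; ring

/-- Close matrices have close spectral thresholds. -/
lemma sum_fsq_thr_sub_thr_le (hU : Uᴴ * U = 1) (hV : Vᴴ * V = 1) (hx1 : ∑ i, x i ^ 2 ≤ 1)
    (hy1 : ∑ i, y i ^ 2 ≤ 1) (ht : 0 < t)
    (hε : fsq (conjDiag U x - conjDiag V y) ≤ 2 * ε) :
    ∑ j : Fin m, fsq (conjDiag U (fun i => thr m j (x i)) -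
      conjDiag V (fun i => thr m j (y i))) ≤ m * (ε / t + 2 * t) + Fintype.card n := by
  have key : ∀ f g : n → ℝ, fsq (conjDiag U f - conjDiag V g) =
      ∑ k, ∑ l, (f k - g l) ^ 2 * Complex.normSq ((Uᴴ * V) k l) := by
    intro f g
    have e := fsq_conjDiag_sub hU hV 1 f (fun _ => 1) (fun _ => 1) g
    simpa only [conjDiag_one hU, conjDiag_one hV, Matrix.one_mul, Matrix.mul_one, mul_one,
      one_mul] using e
  have key' : ∑ k, ∑ l, (x k + y l) ^ 2 * Complex.normSq ((Uᴴ * V) k l) =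
      fsq (conjDiag U x + conjDiag V y) := by
    have e := key x (fun i => -y i)
    have e2 : conjDiag V (fun i => -y i) = - conjDiag V y := by
      have := conjDiag_smul V (-1) y
      simpa using this.symm
    rw [e2, sub_neg_eq_add] at e
    rw [e]
    simp
  have h1 := key x y ▸ hε
  have h2 : ∑ k, ∑ l, (x k + y l) ^ 2 * Complex.normSq ((Uᴴ * V) k l) ≤ 4 := by
    rw [key', fsq_add, fsq_conjDiag hU, fsq_conjDiag hV]
    have := two_mul_fip_le (conjDiag U x) (conjDiag V y)
    rw [fsq_conjDiag hU, fsq_conjDiag hV] at this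
    linarith
  have h3 : ∑ k, ∑ l, Complex.normSq ((Uᴴ * V) k l) = Fintype.card n := by
    have e := key (fun _ => 1) (fun _ => 0)
    simp only [conjDiag_one hU, conjDiag_zero, sub_zero, one_pow, one_mul] at e
    rw [← e, ← conjDiag_one hU, fsq_conjDiag hU]
    simp
  simp only [key]
  rw [Finset.sum_comm]
  calc _ = ∑ k, ∑ l, (∑ j, (thr m j (x k) - thr m j (y l)) ^ 2) *
        Complex.normSq ((Uᴴ * V) k l) := by
        refine Finset.sum_congr rfl fun k _ => ?_
        rw [Finset.sum_comm]
        exact Finset.sum_congr rfl fun l _ => (Finset.sum_mul _ _ _).symm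
    _ ≤ ∑ k, ∑ l, (m / (2 * t) * ((x k - y l) ^ 2 * Complex.normSq ((Uᴴ * V) k l)) +
        m * t / 2 * ((x k + y l) ^ 2 * Complex.normSq ((Uᴴ * V) k l)) +
          Complex.normSq ((Uᴴ * V) k l)) := by
        refine Finset.sum_le_sum fun k _ => Finset.sum_le_sum fun l _ => ?_
        have h4 := sum_thr_sub_sq_le' (m := m) ht (sq_le_one_of_sum_sq hx1 k)
          (sq_le_one_of_sum_sq hy1 l)
        calc _ ≤ _ := mul_le_mul_of_nonneg_right h4 (Complex.normSq_nonneg _)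
          _ = _ := by ring
    _ = m / (2 * t) * (∑ k, ∑ l, (x k - y l) ^ 2 * Complex.normSq ((Uᴴ * V) k l)) +
        m * t / 2 * (∑ k, ∑ l, (x k + y l) ^ 2 * Complex.normSq ((Uᴴ * V) k l)) +
        ∑ k, ∑ l, Complex.normSq ((Uᴴ * V) k l) := by
        simp only [Finset.sum_add_distrib, Finset.mul_sum]
    _ ≤ m / (2 * t) * (2 * ε) + m * t / 2 * 4 + Fintype.card n := by
        rw [h3]; gcongr
    _ = _ := by field_simp; ring

end Commutation

/-! ### Rounding a pair of measurements -/

lemma abs_sum_fip_sub_le {m n β : Type*} [Fintype m] [Fintype n] [Fintype β]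
    {X Y X' Y' : β → Matrix m n ℂ} {s N E E' : ℝ} (hs : 0 < s) (hs1 : s ≤ 1)
    (hX : ∑ i, fsq (X i) ≤ N) (hY : ∑ i, fsq (Y i) ≤ N)
    (hE : ∑ i, fsq (X i - X' i) ≤ E) (hE' : ∑ i, fsq (Y i - Y' i) ≤ E') :
    |∑ i, fip (X i) (Y i) - ∑ i, fip (X' i) (Y' i)| ≤ (E + E') / s + s * N := by
  have e : ∑ i, fip (X i) (Y i) - ∑ i, fip (X' i) (Y' i) =
      ∑ i, fip (X i - X' i) (Y i) + ∑ i, fip (Y i - Y' i) (X i) -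
        ∑ i, fip (X i - X' i) (Y i - Y' i) := by
    simp only [← Finset.sum_add_distrib, ← Finset.sum_sub_distrib]
    refine Finset.sum_congr rfl fun i _ => ?_
    simp only [map_sub, LinearMap.sub_apply, fip_comm (Y i) (X i), fip_comm (Y' i) (X i)]
    ring
  have key : ∀ {r : ℝ}, 0 < r → ∀ Z W : β → Matrix m n ℂ,
      |∑ i, fip (Z i) (W i)| ≤ (∑ i, fsq (Z i)) / (2 * r) + r / 2 * ∑ i, fsq (W i) := by
    intro r hr Z W
    rw [Finset.sum_div, Finset.mul_sum, ← Finset.sum_add_distrib, abs_le']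
    constructor
    · exact Finset.sum_le_sum fun i _ => fip_le hr _ _
    · rw [← Finset.sum_neg_distrib]
      exact Finset.sum_le_sum fun i _ => neg_fip_le hr _ _
  have k1 := key hs (fun i => X i - X' i) Y
  have k2 := key hs (fun i => Y i - Y' i) X
  have k3 := key one_pos (fun i => X i - X' i) (fun i => Y i - Y' i)
  have hE0 : 0 ≤ E := (Finset.sum_nonneg fun i _ => fsq_nonneg _).trans hE
  have hE0' : 0 ≤ E' := (Finset.sum_nonneg fun i _ => fsq_nonneg _).trans hE'
  have l1 : (∑ i, fsq (X i - X' i)) / (2 * s) + s / 2 * ∑ i, fsq (Y i) ≤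
      E / (2 * s) + s / 2 * N := by gcongr
  have l2 : (∑ i, fsq (Y i - Y' i)) / (2 * s) + s / 2 * ∑ i, fsq (X i) ≤
      E' / (2 * s) + s / 2 * N := by gcongr
  have l3 : (E + E') / 2 ≤ (E + E') / (2 * s) := by
    gcongr; linarith
  have l4 : (E + E') / s + s * N = E / (2 * s) + s / 2 * N + (E' / (2 * s) + s / 2 * N) +
      (E + E') / (2 * s) := by field_simp; ring
  rw [e, l4]
  refine (abs_sub _ _).trans (add_le_add ((abs_add_le _ _).trans (add_le_add ?_ ?_)) ?_)
  · exact k1.trans l1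
  · exact k2.trans l2
  · exact k3.trans (by linarith)

section Rounding

variable {n α : Type*} [Fintype n] [DecidableEq n] [Fintype α]
  {U V : Matrix n n ℂ} {x y : n → ℝ} {Q R : α → Matrix n n ℂ} {ε s : ℝ} {m : ℕ}

lemma sum_fsq_thr_le (hU : Uᴴ * U = 1) (hx1 : ∑ i, x i ^ 2 ≤ 1) :
    ∑ j : Fin m, fsq (conjDiag U fun i => thr m j (x i)) ≤ m := by
  calc ∑ j : Fin m, fsq (conjDiag U fun i => thr m j (x i)) = ∑ i, ∑ j, thr m j (x i) := by
        rw [Finset.sum_comm]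
        refine Finset.sum_congr rfl fun j _ => ?_
        rw [fsq_conjDiag hU]
        exact Finset.sum_congr rfl fun i _ => by rw [sq, thr_mul_self]
    _ ≤ ∑ i, m * x i ^ 2 :=
        Finset.sum_le_sum fun i _ => sum_thr_le (sq_le_one_of_sum_sq hx1 i)
    _ ≤ m * 1 := by rw [← Finset.mul_sum]; gcongr
    _ = m := mul_one _

lemma le_sum_fip_mul_thr (hU : Uᴴ * U = 1) (hx1 : ∑ i, x i ^ 2 ≤ 1)
    (hQ : IsSubPOVM Q) (hR : IsSubPOVM R) :
    m * ∑ a, fip (Q a * conjDiag U x) (R a * conjDiag U x) - Fintype.card n ≤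
      ∑ j : Fin m, ∑ a, fip (Q a * conjDiag U fun i => thr m j (x i))
        (R a * conjDiag U fun i => thr m j (x i)) := by
  set δ : n → ℝ := fun i => m * x i ^ 2 - ∑ j, thr m j (x i) with hδ
  have hδ0 : ∀ i, 0 ≤ δ i := fun i =>
    sub_nonneg.2 (sum_thr_le (sq_le_one_of_sum_sq hx1 i))
  have hδ1 : ∀ i, δ i ≤ 1 := fun i => by
    have := le_sum_thr (m := m) (sq_le_one_of_sum_sq hx1 i)
    simp only [hδ]; linarith
  have key : ∀ (f : n → ℝ) (a : α), fip (Q a * conjDiag U f) (R a * conjDiag U f) =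
      fip (Q a * conjDiag U fun i => f i * f i) (R a) := by
    intro f a
    rw [← fip_mul_right' (conjDiag_isHermitian U f), Matrix.mul_assoc, conjDiag_mul hU]
  have h1 : ∑ a, fip (Q a * conjDiag U fun i => √(δ i)) (R a * conjDiag U fun i => √(δ i)) ≤
      Fintype.card n := by
    have hc : fsq (conjDiag U fun i => √(δ i)) ≤ Fintype.card n := by
      rw [fsq_conjDiag hU]
      simp only [Real.sq_sqrt (hδ0 _)]
      exact (Finset.sum_le_sum fun i _ => hδ1 i).trans (by simp)
    have h2 := hQ.fsq_mul_le (conjDiag U fun i => √(δ i))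
    have h3 := hR.fsq_mul_le (conjDiag U fun i => √(δ i))
    have h4 := Finset.sum_le_sum fun a (_ : a ∈ Finset.univ) =>
      two_mul_fip_le (Q a * conjDiag U fun i => √(δ i)) (R a * conjDiag U fun i => √(δ i))
    rw [← Finset.mul_sum, Finset.sum_add_distrib] at h4
    linarith
  simp only [key, Real.mul_self_sqrt (hδ0 _), thr_mul_self] at h1 ⊢
  rw [Finset.sum_comm]
  have h2 : ∀ a, m * fip (Q a * conjDiag U fun i => x i * x i) (R a) -
      ∑ j : Fin m, fip (Q a * conjDiag U fun i => thr m j (x i)) (R a) =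
      fip (Q a * conjDiag U δ) (R a) := by
    intro a
    have e : conjDiag U δ = (m : ℝ) • conjDiag U (fun i => x i * x i) -
        ∑ j : Fin m, conjDiag U fun i => thr m j (x i) := by
      rw [conjDiag_sum, conjDiag_smul, conjDiag_sub]
      simp only [hδ, sq]
    rw [e, Matrix.mul_sub, Matrix.mul_smul, Finset.mul_sum]
    simp
  have h3 := Finset.sum_congr (rfl : Finset.univ = Finset.univ)
    fun a (_ : a ∈ Finset.univ) => h2 a
  rw [Finset.sum_sub_distrib, ← Finset.mul_sum] at h3
  linarith

/-- If `K^{1/2} Q K^{1/2}` and `L^{1/2} R L^{1/2}` have inner product almost one, then so do, on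
average, the compressions of `Q` and `R` to the spectral thresholds of `K` and `L`. -/
lemma le_sum_fip_thr (hU : Uᴴ * U = 1) (hV : Vᴴ * V = 1) (hx : ∀ i, 0 ≤ x i) (hy : ∀ i, 0 ≤ y i)
    (hx1 : ∑ i, x i ^ 2 ≤ 1) (hy1 : ∑ i, y i ^ 2 ≤ 1) (hQ : IsSubPOVM Q) (hR : IsSubPOVM R)
    (hs : 0 < s) (hs1 : s ≤ 1)
    (hε : ∑ a, fip (conjDiag U (fun i => √(x i)) * Q a * conjDiag U (fun i => √(x i)))
      (conjDiag V (fun i => √(y i)) * R a * conjDiag V (fun i => √(y i))) = 1 - ε) :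
    m * (1 - 11 * s - 12 * (ε / s ^ 3)) - 4 * (Fintype.card n / s) ≤
      ∑ j : Fin m, ∑ a,
        fip (conjDiag U (fun i => thr m j (x i)) * Q a * conjDiag U (fun i => thr m j (x i)))
          (conjDiag V (fun i => thr m j (y i)) * R a * conjDiag V (fun i => thr m j (y i))) := by
  have hK : fsq (conjDiag U x) ≤ 1 := by rwa [fsq_conjDiag hU]
  have hL : fsq (conjDiag V y) ≤ 1 := by rwa [fsq_conjDiag hV]
  have b1 := sum_fsq_sqrt_mul_mul_le hU hx hQ
  have b2 := sum_fsq_sqrt_mul_mul_le hV hy hR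
  have b3 := Finset.sum_le_sum fun a (_ : a ∈ Finset.univ) => two_mul_fip_le
    (conjDiag U (fun i => √(x i)) * Q a * conjDiag U (fun i => √(x i)))
    (conjDiag V (fun i => √(y i)) * R a * conjDiag V (fun i => √(y i)))
  rw [← Finset.mul_sum, Finset.sum_add_distrib, hε] at b3
  have hε0 : 0 ≤ ε := by linarith
  have hεU : 1 - 2 * ε ≤
      ∑ a, fsq (conjDiag U (fun i => √(x i)) * Q a * conjDiag U (fun i => √(x i))) := by linarith
  have hεV : 1 - 2 * ε ≤
      ∑ a, fsq (conjDiag V (fun i => √(y i)) * R a * conjDiag V (fun i => √(y i))) := by linarith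
  have hKL : fsq (conjDiag U x - conjDiag V y) ≤ 2 * ε := by
    have aux : ∀ {U : Matrix n n ℂ} {x : n → ℝ} {Q : α → Matrix n n ℂ}, Uᴴ * U = 1 →
        (∀ i, 0 ≤ x i) → IsSubPOVM Q → (∀ a, (conjDiag U (fun i => √(x i)) * Q a *
          conjDiag U (fun i => √(x i))).PosSemidef) ∧ (conjDiag U x - ∑ a,
            conjDiag U (fun i => √(x i)) * Q a * conjDiag U (fun i => √(x i))).PosSemidef := by
      intro U x Q hU hx hQ
      have hH := conjDiag_isHermitian U (fun i => √(x i))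
      have hpsd : ∀ {M : Matrix n n ℂ}, M.PosSemidef →
          (conjDiag U (fun i => √(x i)) * M * conjDiag U (fun i => √(x i))).PosSemidef := by
        intro M hM
        simpa only [hH.eq] using hM.mul_mul_conjTranspose_same (conjDiag U (fun i => √(x i)))
      refine ⟨fun a => hpsd (hQ.1 a), ?_⟩
      have e : conjDiag U x - ∑ a,
          conjDiag U (fun i => √(x i)) * Q a * conjDiag U (fun i => √(x i)) =
          conjDiag U (fun i => √(x i)) * (1 - ∑ a, Q a) * conjDiag U (fun i => √(x i)) := by
        rw [Matrix.mul_sub, Matrix.sub_mul, Matrix.mul_one, conjDiag_mul hU, Finset.mul_sum,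
          Finset.sum_mul]
        simp only [Real.mul_self_sqrt (hx _)]
      rw [e]
      exact hpsd hQ.2
    obtain ⟨p1, p2⟩ := aux hU hx hQ
    obtain ⟨q1, q2⟩ := aux hV hy hR
    have := sum_fip_le p1 q1 p2 q2
    rw [fsq_sub]
    linarith
  have ht : 0 < s ^ 2 := by positivity
  have hP := sum_fsq_thr_le (m := m) hU hx1
  have hS := sum_fsq_thr_le (m := m) hV hy1
  have hQP : ∑ j : Fin m, ∑ a, fsq (Q a * conjDiag U fun i => thr m j (x i)) ≤ m :=
    (Finset.sum_le_sum fun j _ => hQ.fsq_mul_le _).trans hP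
  have hRP : ∑ j : Fin m, ∑ a, fsq (R a * conjDiag U fun i => thr m j (x i)) ≤ m :=
    (Finset.sum_le_sum fun j _ => hR.fsq_mul_le _).trans hP
  have hRS : ∑ j : Fin m, ∑ a, fsq (R a * conjDiag V fun i => thr m j (y i)) ≤ m :=
    (Finset.sum_le_sum fun j _ => hR.fsq_mul_le _).trans hS
  have s1 := abs_sum_fip_sub_le (β := Fin m × α)
    (E := m * (2 * ε / s ^ 2 + 2 * s ^ 2) + Fintype.card n)
    (E' := m * (2 * ε / s ^ 2 + 2 * s ^ 2) + Fintype.card n)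
    (X := fun p => Q p.2 * conjDiag U (fun i => thr m p.1 (x i)))
    (Y := fun p => R p.2 * conjDiag V (fun i => thr m p.1 (y i)))
    (X' := fun p => conjDiag U (fun i => thr m p.1 (x i)) * Q p.2 *
      conjDiag U (fun i => thr m p.1 (x i)))
    (Y' := fun p => conjDiag V (fun i => thr m p.1 (y i)) * R p.2 *
      conjDiag V (fun i => thr m p.1 (y i))) (N := m) hs hs1
    (by rw [Fintype.sum_prod_type]; exact hQP) (by rw [Fintype.sum_prod_type]; exact hRS)
    (by rw [Fintype.sum_prod_type]; exact sum_fsq_thr_sub_le hU hx hx1 hQ ht hεU)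
    (by rw [Fintype.sum_prod_type]; exact sum_fsq_thr_sub_le hV hy hy1 hR ht hεV)
  have hPS : ∑ j : Fin m, ∑ a, fsq (R a * conjDiag U (fun i => thr m j (x i)) -
      R a * conjDiag V fun i => thr m j (y i)) ≤ m * (ε / s ^ 2 + 2 * s ^ 2) + Fintype.card n := by
    simp only [← Matrix.mul_sub]
    exact (Finset.sum_le_sum fun j _ => hR.fsq_mul_le _).trans
      (sum_fsq_thr_sub_thr_le hU hV hx1 hy1 ht hKL)
  have s2 := abs_sum_fip_sub_le (β := Fin m × α)
    (E := 0) (E' := m * (ε / s ^ 2 + 2 * s ^ 2) + Fintype.card n)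
    (X := fun p => Q p.2 * conjDiag U (fun i => thr m p.1 (x i)))
    (X' := fun p => Q p.2 * conjDiag U (fun i => thr m p.1 (x i)))
    (Y := fun p => R p.2 * conjDiag U (fun i => thr m p.1 (x i)))
    (Y' := fun p => R p.2 * conjDiag V (fun i => thr m p.1 (y i))) (N := m) hs hs1
    (by rw [Fintype.sum_prod_type]; exact hQP) (by rw [Fintype.sum_prod_type]; exact hRP)
    (by simp [fsq]) (by rw [Fintype.sum_prod_type]; exact hPS)
  have s3 := le_sum_fip_mul_thr (m := m) hU hx1 hQ hR
  have s4 := abs_sum_fip_sub_le (β := α) (E := 0)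
    (X := fun a => Q a * conjDiag U x) (X' := fun a => Q a * conjDiag U x)
    (Y := fun a => R a * conjDiag U x) (Y' := fun a => R a * conjDiag V y) (N := 1) hs hs1
    ((hQ.fsq_mul_le _).trans hK) ((hR.fsq_mul_le _).trans hK) (by simp [fsq])
    (by simp only [← Matrix.mul_sub]; exact (hR.fsq_mul_le _).trans hKL)
  have s5 := abs_sum_fip_sub_le (β := α)
    (X := fun a => Q a * conjDiag U x) (Y := fun a => R a * conjDiag V y) (N := 1) hs hs1
    ((hQ.fsq_mul_le _).trans hK) ((hR.fsq_mul_le _).trans hL)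
    (sum_fsq_mul_sub_le hU hx hx1 hQ ht hεU) (sum_fsq_mul_sub_le hV hy hy1 hR ht hεV)
  rw [Fintype.sum_prod_type, Fintype.sum_prod_type] at s1 s2
  have r1 := (abs_le.1 s1).2
  have r2 := (abs_le.1 s2).2
  have r4 := (abs_le.1 s4).1
  have r5 := (abs_le.1 s5).1
  rw [hε] at r5
  have hm : (0 : ℝ) ≤ m := Nat.cast_nonneg m
  have hD : (0 : ℝ) ≤ Fintype.card n := Nat.cast_nonneg _
  have e1 : (m * (2 * ε / s ^ 2 + 2 * s ^ 2) + Fintype.card n +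
      (m * (2 * ε / s ^ 2 + 2 * s ^ 2) + Fintype.card n)) / s + s * m =
      m * (4 * (ε / s ^ 3) + 5 * s) + 2 * (Fintype.card n / s) := by field_simp; ring
  have e2 : (0 + (m * (ε / s ^ 2 + 2 * s ^ 2) + Fintype.card n)) / s + s * m =
      m * (ε / s ^ 3 + 3 * s) + Fintype.card n / s := by field_simp; ring
  have e5 : (2 * ε / s ^ 2 + s ^ 2 / 2 + (2 * ε / s ^ 2 + s ^ 2 / 2)) / s + s * 1 =
      4 * (ε / s ^ 3) + 2 * s := by field_simp; ring
  have hs3 : s ^ 3 ≤ s := by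
    have : s ^ 3 ≤ s ^ 1 := pow_le_pow_of_le_one hs.le hs1 (by norm_num)
    simpa using this
  have e4 : (0 + 2 * ε) / s ≤ 2 * (ε / s ^ 3) := by
    rw [zero_add, mul_div_assoc]; gcongr
  have e0 : ε ≤ ε / s ^ 3 := le_div_self hε0 (by positivity) (hs3.trans hs1)
  have e6 : (Fintype.card n : ℝ) ≤ Fintype.card n / s := le_div_self hD hs hs1
  rw [e1] at r1
  rw [e2] at r2
  rw [e5] at r5
  have hfin : 1 - 3 * s - 7 * (ε / s ^ 3) ≤
      ∑ a, fip (Q a * conjDiag U x) (R a * conjDiag U x) := by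
    have : (0 + 2 * ε) / s + s * 1 ≤ 2 * (ε / s ^ 3) + s := by linarith
    linarith
  have := mul_le_mul_of_nonneg_left hfin hm
  linarith

end Rounding

/-! ### Completing a sub-POVM by iterated sampling -/

section Sampling

lemma fip_kronecker {m n : Type*} [Fintype m] [Fintype n] {A C : Matrix m m ℂ}
    {B D : Matrix n n ℂ} (hA : A.IsHermitian) (hC : C.IsHermitian) :
    fip (A ⊗ₖ B) (C ⊗ₖ D) = fip A C * fip B D := by
  have him : ((Aᴴ * C).trace).im = 0 := by
    rw [← Complex.conj_eq_iff_im]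
    change star _ = _
    rw [← trace_conjTranspose, conjTranspose_mul, conjTranspose_conjTranspose, hC.eq, hA.eq,
      trace_mul_comm]
  rw [fip_def, conjTranspose_kronecker, ← mul_kronecker_mul, trace_kronecker, Complex.mul_re, him,
    zero_mul, sub_zero]
  rfl

lemma fip_one_one (n : Type*) [Fintype n] [DecidableEq n] :
    fip (1 : Matrix n n ℂ) 1 = Fintype.card n := by
  simp [fip_def]

variable {α β : Type} [Fintype α] [DecidableEq α] [Fintype β]

/-- The (unnormalised) probability that the measurements `T`, `S`, applied to a maximally
entangled state, produce matching outcomes. -/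
def corr {n : Type*} [Fintype n] (π π' : β → Option α) (T S : β → Matrix n n ℂ) : ℝ :=
  ∑ a, fip (fiber π T a) (fiber π' S a)

lemma corr_nonneg {n : Type*} [Fintype n] {π π' : β → Option α} {T S : β → Matrix n n ℂ}
    (hT : ∀ b, (T b).PosSemidef) (hS : ∀ b, (S b).PosSemidef) : 0 ≤ corr π π' T S :=
  Finset.sum_nonneg fun a _ => fip_nonneg (fiber_posSemidef hT π a) (fiber_posSemidef hS π' a)

section

variable {m n : Type*} [Fintype m] [Fintype n] [DecidableEq m] [DecidableEq n]

/-- Measure with `T`; if it gives no outcome, measure with `T'` on a fresh system. -/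
def fallback (T : β → Matrix m m ℂ) (T' : β → Matrix n n ℂ) (b : β) :
    Matrix (m × n) (m × n) ℂ :=
  T b ⊗ₖ 1 + (1 - ∑ b, T b) ⊗ₖ T' b

lemma fallback_posSemidef {T : β → Matrix m m ℂ} {T' : β → Matrix n n ℂ} (hT : IsSubPOVM T)
    (hT' : ∀ b, (T' b).PosSemidef) (b : β) : (fallback T T' b).PosSemidef :=
  ((hT.1 b).kronecker PosSemidef.one).add (hT.2.kronecker (hT' b))

omit [Fintype m] [Fintype n] in
lemma sum_fallback {T : β → Matrix m m ℂ} {T' : β → Matrix n n ℂ} (hT' : ∑ b, T' b = 1) :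
    ∑ b, fallback T T' b = 1 := by
  have h1 : ∀ (X : β → Matrix m m ℂ) (Y : Matrix n n ℂ), ∑ b, X b ⊗ₖ Y = (∑ b, X b) ⊗ₖ Y :=
    fun X Y => (map_sum (AddMonoidHom.mk' (fun Z : Matrix m m ℂ => Z ⊗ₖ Y)
      fun _ _ => add_kronecker _ _ _) X _).symm
  have h2 : ∀ (X : Matrix m m ℂ) (Y : β → Matrix n n ℂ), ∑ b, X ⊗ₖ Y b = X ⊗ₖ ∑ b, Y b :=
    fun X Y => (map_sum (AddMonoidHom.mk' (fun Z : Matrix n n ℂ => X ⊗ₖ Z)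
      fun _ _ => kronecker_add _ _ _) Y _).symm
  simp only [fallback, Finset.sum_add_distrib]
  rw [h1, h2, hT', ← add_kronecker]
  simp

omit [Fintype α] [Fintype m] [Fintype n] in
lemma fiber_fallback (π : β → Option α) (T : β → Matrix m m ℂ) (T' : β → Matrix n n ℂ) (a : α) :
    fiber π (fallback T T') a = fiber π T a ⊗ₖ 1 + (1 - ∑ b, T b) ⊗ₖ fiber π T' a := by
  have h1 := fiber_map (AddMonoidHom.mk' (fun Z : Matrix m m ℂ => Z ⊗ₖ (1 : Matrix n n ℂ))
      fun _ _ => add_kronecker _ _ _) π T a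
  have h2 := fiber_map (AddMonoidHom.mk' (fun Z : Matrix n n ℂ => (1 - ∑ b, T b) ⊗ₖ Z)
      fun _ _ => kronecker_add _ _ _) π T' a
  simp only [AddMonoidHom.mk'_apply] at h1 h2
  rw [h1, h2]
  simp only [fiber, ← Finset.sum_add_distrib]
  refine Finset.sum_congr rfl fun b _ => ?_
  split_ifs <;> simp [fallback]

lemma le_corr_fallback {π π' : β → Option α} {T S : β → Matrix m m ℂ} {T' S' : β → Matrix n n ℂ}
    (hT : IsSubPOVM T) (hS : IsSubPOVM S) (hT' : ∀ b, (T' b).PosSemidef)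
    (hS' : ∀ b, (S' b).PosSemidef) :
    corr π π' T S * Fintype.card n + fip (1 - ∑ b, T b) (1 - ∑ b, S b) * corr π π' T' S' ≤
      corr π π' (fallback T T') (fallback S S') := by
  simp only [corr, Finset.sum_mul, Finset.mul_sum, ← Finset.sum_add_distrib]
  refine Finset.sum_le_sum fun a _ => ?_
  have p1 := fiber_posSemidef hT.1 π a
  have p2 := fiber_posSemidef hS.1 π' a
  have p3 := fiber_posSemidef hT' π a
  have p4 := fiber_posSemidef hS' π' a
  have c1 := fip_nonneg (p1.kronecker (PosSemidef.one (n := n))) (hS.2.kronecker p4)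
  have c2 := fip_nonneg (hT.2.kronecker p3) (p2.kronecker (PosSemidef.one (n := n)))
  rw [fiber_fallback, fiber_fallback]
  simp only [map_add, LinearMap.add_apply]
  rw [fip_kronecker p1.1 p2.1, fip_kronecker hT.2.1 hS.2.1, fip_one_one]
  linarith

end

/-- A sub-POVM of small trace whose members correlate well can be completed to a POVM. -/
lemma exists_povm_of_subPOVM {ν n : Type} [Fintype n] [DecidableEq n] [Nonempty n] [Nonempty β]
    {T : ν → β → Matrix n n ℂ} (hT : ∀ v, IsSubPOVM (T v)) {p : ℝ} (hp : 0 < p) (hp1 : p ≤ 1)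
    (htr : ∀ v, fip 1 (∑ b, T v b) ≤ p * Fintype.card n) (N : ℕ) :
    ∃ (k : Type) (_ : Fintype k) (_ : DecidableEq k) (_ : Nonempty k) (S : ν → β → Matrix k k ℂ),
      (∀ v b, (S v b).PosSemidef) ∧ (∀ v, ∑ b, S v b = 1) ∧
      ∀ (v v' : ν) (π π' : β → Option α),
        2 * (corr π π' (T v) (T v') / Fintype.card n) / p - 1 - (1 - p / 2) ^ N ≤
          corr π π' (S v) (S v') / Fintype.card k := by
  classical
  have hn : (0 : ℝ) < Fintype.card n := by exact_mod_cast Fintype.card_pos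
  have hsum : ∀ v, (∑ b, T v b).PosSemidef := fun v => posSemidef_sum _ fun b _ => (hT v).1 b
  have hle : ∀ v v', fip (∑ b, T v b) (∑ b, T v' b) ≤ fip 1 (∑ b, T v' b) := fun v v' =>
    fip_le_fip (hsum v) (hsum v') (hT v).2 (by simpa using PosSemidef.zero)
  have hq : ∀ v v' (π π' : β → Option α),
      corr π π' (T v) (T v') ≤ fip (∑ b, T v b) (∑ b, T v' b) :=
    fun v v' π π' => sum_fip_fiber_le (hT v).1 (hT v').1 π π'
  induction N with
  | zero =>
    obtain ⟨b₀⟩ := ‹Nonempty β›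
    have hpsd : ∀ b : β, (if b = b₀ then (1 : Matrix Unit Unit ℂ) else 0).PosSemidef := by
      intro b; split_ifs
      exacts [PosSemidef.one, PosSemidef.zero]
    refine ⟨Unit, inferInstance, inferInstance, inferInstance,
      fun _ b => if b = b₀ then 1 else 0, fun _ => hpsd, fun _ => by simp, fun v v' π π' => ?_⟩
    have h1 : 2 * (corr π π' (T v) (T v') / Fintype.card n) / p ≤ 2 := by
      rw [div_le_iff₀ hp, mul_le_mul_iff_right₀ two_pos, div_le_iff₀ hn]
      exact ((hq v v' π π').trans (hle v v')).trans (htr v')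
    have h2 := corr_nonneg (π := π) (π' := π') hpsd hpsd
    simp only [pow_zero, Fintype.card_unit, Nat.cast_one, div_one]
    linarith
  | succ N ih =>
    obtain ⟨k, _, _, _, S, hS, hS1, hSc⟩ := ih
    have hk : (0 : ℝ) < Fintype.card k := by exact_mod_cast Fintype.card_pos
    refine ⟨n × k, inferInstance, inferInstance, inferInstance, fun v => fallback (T v) (S v),
      fun v => fallback_posSemidef (hT v) (hS v), fun v => sum_fallback (hS1 v),
      fun v v' π π' => ?_⟩
    set q := corr π π' (T v) (T v') / Fintype.card n with hqdef
    set c := corr π π' (S v) (S v') / Fintype.card k with hcdef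
    set r := fip (1 - ∑ b, T v b) (1 - ∑ b, T v' b) / Fintype.card n with hrdef
    have hc := hSc v v' π π'
    rw [← hqdef, ← hcdef] at hc
    have hq0 : 0 ≤ q := div_nonneg (corr_nonneg (hT v).1 (hT v').1) hn.le
    have hc0 : 0 ≤ c := div_nonneg (corr_nonneg (hS v) (hS v')) hk.le
    have hr0 : 0 ≤ r := div_nonneg (fip_nonneg (hT v).2 (hT v').2) hn.le
    have hrr : r = 1 - fip 1 (∑ b, T v b) / Fintype.card n - fip 1 (∑ b, T v' b) / Fintype.card n
        + fip (∑ b, T v b) (∑ b, T v' b) / Fintype.card n := by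
      rw [hrdef]
      simp only [map_sub, LinearMap.sub_apply, fip_one_one, fip_comm (∑ b, T v b) 1]
      field_simp
      ring
    have d1 : fip 1 (∑ b, T v b) / Fintype.card n ≤ p := by rw [div_le_iff₀ hn]; exact htr v
    have d2 : fip 1 (∑ b, T v' b) / Fintype.card n ≤ p := by rw [div_le_iff₀ hn]; exact htr v'
    have d3 : q ≤ fip (∑ b, T v b) (∑ b, T v' b) / Fintype.card n := by
      rw [hqdef]; gcongr; exact hq v v' π π'
    have d4 : fip (∑ b, T v b) (∑ b, T v' b) / Fintype.card n ≤
        fip 1 (∑ b, T v' b) / Fintype.card n := by gcongr; exact hle v v'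
    have d5 : fip (∑ b, T v b) (∑ b, T v' b) / Fintype.card n ≤
        fip 1 (∑ b, T v b) / Fintype.card n := by
      rw [fip_comm]; gcongr; exact hle v' v
    have hstep : q + r * c ≤
        corr π π' (fallback (T v) (S v)) (fallback (T v') (S v')) / Fintype.card (n × k) := by
      rw [Fintype.card_prod, Nat.cast_mul, le_div_iff₀ (mul_pos hn hk)]
      refine le_trans (le_of_eq ?_) (le_corr_fallback (hT v) (hT v') (hS v) (hS v'))
      rw [hqdef, hcdef, hrdef]
      field_simp
    refine le_trans ?_ hstep
    set z := 1 - p / 2 with hz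
    have hz0 : 0 ≤ z ^ (N + 1) := pow_nonneg (by rw [hz]; linarith) _
    have hzN : 0 ≤ z ^ N := pow_nonneg (by rw [hz]; linarith) _
    set g := 2 * q / p - 1 with hg
    have hgp : g * p = 2 * q - p := by rw [hg]; field_simp
    rcases le_or_gt g 0 with h | h
    · have := mul_nonneg hr0 hc0
      linarith
    · have hqp : p / 2 ≤ q := by nlinarith
      have e1 : 1 - r ≤ 2 * p - q := by rw [hrr]; linarith
      have e2 : q ≤ 1 - r := by rw [hrr]; linarith
      have e3 : (2 * p - q) * g ≤ q := by
        have : ((2 * p - q) * g) * p ≤ q * p := by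
          rw [mul_assoc, hgp]; nlinarith [sq_nonneg (p - q)]
        exact le_of_mul_le_mul_right this hp
      have e4 : (1 - r) * g ≤ q := (mul_le_mul_of_nonneg_right e1 h.le).trans e3
      have e5 : r * z ^ N ≤ z ^ (N + 1) := by
        rw [pow_succ']
        exact mul_le_mul_of_nonneg_right (by rw [hz]; linarith) hzN
      have e6 := mul_le_mul_of_nonneg_left hc hr0
      nlinarith

end Sampling

/-! ### The relaxed value -/

namespace ProjGame

section Relax

variable (G : ProjGame) {ι : Type*} [Fintype ι]

lemma μL_nonneg (u : G.U) : 0 ≤ G.μL u := Finset.sum_nonneg fun _ _ => G.μ_nonneg _ _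

lemma sum_μL : ∑ u, G.μL u = 1 := G.μ_sum

lemma μc_nonneg (u : G.U) (v : G.V) : 0 ≤ G.μc u v :=
  div_nonneg (G.μ_nonneg _ _) (G.μL_nonneg _)

lemma μL_mul_μc (u : G.U) (v : G.V) : G.μL u * G.μc u v = G.μ u v := by
  unfold μc
  by_cases h : G.μL u = 0
  · have := (Finset.sum_eq_zero_iff_of_nonneg fun v _ => G.μ_nonneg u v).1 h v (Finset.mem_univ v)
    rw [h, this]; simp
  · field_simp

/-- The expectation of `f u v v'` where `u` is a random question to the first player and `v`, `v'`
are independent random neighbours of `u`. -/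
def avg (f : G.U → G.V → G.V → ℝ) : ℝ :=
  ∑ u, ∑ v, ∑ v', G.μL u * G.μc u v * G.μc u v' * f u v v'

lemma avg_mono {f g : G.U → G.V → G.V → ℝ} (h : ∀ u v v', f u v v' ≤ g u v v') :
    G.avg f ≤ G.avg g :=
  Finset.sum_le_sum fun u _ => Finset.sum_le_sum fun v _ => Finset.sum_le_sum fun v' _ =>
    mul_le_mul_of_nonneg_left (h u v v')
      (mul_nonneg (mul_nonneg (G.μL_nonneg u) (G.μc_nonneg u v)) (G.μc_nonneg u v'))

lemma avg_affine (c d : ℝ) (f : G.U → G.V → G.V → ℝ) :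
    G.avg (fun u v v' => c + d * f u v v') = c + d * G.avg f := by
  have h1 : ∑ u, ∑ v, ∑ v', G.μL u * G.μc u v * G.μc u v' = 1 := by
    rw [← G.sum_μL]
    refine Finset.sum_congr rfl fun u _ => ?_
    have e : ∑ v, G.μL u * G.μc u v = G.μL u := by simp only [μL_mul_μc]; rfl
    simp only [← Finset.mul_sum, ← Finset.sum_mul] at e ⊢
    rw [e, e]
  calc G.avg (fun u v v' => c + d * f u v v')
      = c * (∑ u, ∑ v, ∑ v', G.μL u * G.μc u v * G.μc u v') + d * G.avg f := by
        simp only [avg, Finset.mul_sum, ← Finset.sum_add_distrib]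
        refine Finset.sum_congr rfl fun u _ => Finset.sum_congr rfl fun v _ =>
          Finset.sum_congr rfl fun v' _ => by ring
    _ = _ := by rw [h1, mul_one]

lemma avg_const (c : ℝ) : G.avg (fun _ _ _ => c) = c := by
  simpa using G.avg_affine c 0 fun _ _ _ => 0

/-- The operators `∑_v μ(v|u) ∑_{b → a} K_v^b`. -/
def push (K : G.V → G.B → Matrix ι ι ℂ) (u : G.U) (a : G.A) : Matrix ι ι ℂ :=
  ∑ v, G.μc u v • fiber (G.proj u v) (K v) a

/-- The quadratic form `E_u ∑_a ‖push K u a‖²`. -/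
def energy (K : G.V → G.B → Matrix ι ι ℂ) : ℝ :=
  ∑ u, G.μL u * ∑ a, fsq (G.push K u a)

lemma energy_eq_avg (K : G.V → G.B → Matrix ι ι ℂ) :
    G.energy K = G.avg fun u v v' => corr (G.proj u v) (G.proj u v') (K v) (K v') := by
  simp only [energy, avg]
  refine Finset.sum_congr rfl fun u _ => ?_
  have h : ∀ a, fsq (G.push K u a) = ∑ v, ∑ v', G.μc u v * G.μc u v' *
      fip (fiber (G.proj u v) (K v) a) (fiber (G.proj u v') (K v') a) := by
    intro a
    simp only [fsq, push, map_sum, LinearMap.sum_apply, map_smul, LinearMap.smul_apply,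
      smul_eq_mul, Finset.mul_sum]
    rw [Finset.sum_comm]
    exact Finset.sum_congr rfl fun v _ => Finset.sum_congr rfl fun v' _ => by ring
  simp only [h]
  rw [Finset.sum_comm, Finset.mul_sum]
  refine Finset.sum_congr rfl fun v _ => ?_
  rw [Finset.sum_comm, Finset.mul_sum]
  refine Finset.sum_congr rfl fun v' _ => ?_
  rw [← Finset.mul_sum, corr]
  ring

omit [Fintype ι] in
lemma push_posSemidef {K : G.V → G.B → Matrix ι ι ℂ} (hK : ∀ v b, (K v b).PosSemidef)
    (u : G.U) (a : G.A) : (G.push K u a).PosSemidef :=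
  posSemidef_sum _ fun v _ => (fiber_posSemidef (hK v) _ a).smul (G.μc_nonneg u v)

/-- `x` bounds the energy of every family of positive semidefinite matrices, relative to the
largest squared Frobenius norm of `∑ b, K v b`. -/
def RelaxBound (x : ℝ) : Prop :=
  ∀ (ι : Type) [Fintype ι] [DecidableEq ι] (K : G.V → G.B → Matrix ι ι ℂ) (r : ℝ),
    (∀ v b, (K v b).PosSemidef) → (∀ v, fsq (∑ b, K v b) ≤ r) → G.energy K ≤ x * r

lemma relaxBound_one : G.RelaxBound 1 := by
  intro ι _ _ K r hK hr
  rw [energy_eq_avg, one_mul, ← G.avg_const r]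
  refine G.avg_mono fun u v v' => ?_
  have h1 : corr (G.proj u v) (G.proj u v') (K v) (K v') ≤ _ :=
    sum_fip_fiber_le (hK v) (hK v') (G.proj u v) (G.proj u v')
  have h2 := two_mul_fip_le (∑ b, K v b) (∑ b, K v' b)
  linarith [hr v, hr v']

variable {G} in
lemma RelaxBound.sum_le {x : ℝ} (h : G.RelaxBound x) {ι o : Type} [Fintype ι] [DecidableEq ι]
    [Fintype o] {w : o → ℝ} (hw : ∀ p, 0 ≤ w p) {K : o → G.V → G.B → Matrix ι ι ℂ}
    (hK : ∀ p v b, (K p v b).PosSemidef) {r : ℝ}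
    (hr : ∀ v, ∑ p, w p * fsq (∑ b, K p v b) ≤ r) : ∑ p, w p * G.energy (K p) ≤ x * r := by
  classical
  have hpsd : ∀ v b p, (√(w p) • K p v b).PosSemidef :=
    fun v b p => (hK p v b).smul (Real.sqrt_nonneg _)
  have hfs : ∀ X Y : o → Matrix ι ι ℂ, fip (blockDiagonal fun p => √(w p) • X p)
      (blockDiagonal fun p => √(w p) • Y p) = ∑ p, w p * fip (X p) (Y p) := by
    intro X Y
    rw [fip_blockDiagonal]
    refine Finset.sum_congr rfl fun p _ => ?_
    simp only [map_smul, LinearMap.smul_apply, smul_eq_mul]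
    rw [← mul_assoc, Real.mul_self_sqrt (hw p)]
  have hadd : ∀ X : G.B → o → Matrix ι ι ℂ, ∑ b, blockDiagonal (X b) =
      blockDiagonal (fun p => ∑ b, X b p) := by
    intro X
    refine (map_sum (blockDiagonalAddMonoidHom ι ι o ℂ) X Finset.univ).symm.trans ?_
    exact congrArg blockDiagonal (funext fun p => Finset.sum_apply _ _ _)
  have hfib : ∀ (π : G.B → Option G.A) v a,
      fiber π (fun b => blockDiagonal fun p => √(w p) • K p v b) a =
        blockDiagonal fun p => √(w p) • fiber π (K p v) a := by
    intro π v a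
    have e := fiber_map (blockDiagonalAddMonoidHom ι ι o ℂ) π
      (fun b p => √(w p) • K p v b) a
    simp only [blockDiagonalAddMonoidHom_apply] at e
    rw [← e]
    congr 1
    funext p
    simp only [fiber, Finset.sum_apply, Finset.smul_sum]
    refine Finset.sum_congr rfl fun b _ => ?_
    split_ifs <;> simp
  have key := h (ι × o) (fun v b => blockDiagonal fun p => √(w p) • K p v b) r
    (fun v b => blockDiagonal_posSemidef fun p => hpsd v b p) fun v => by
      rw [hadd]
      simp only [← Finset.smul_sum]
      rw [fsq, hfs]
      exact hr v
  refine le_trans (le_of_eq ?_) key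
  simp only [energy_eq_avg, corr, hfib, hfs]
  simp only [avg, Finset.mul_sum]
  rw [Finset.sum_comm]
  refine Finset.sum_congr rfl fun u _ => ?_
  rw [Finset.sum_comm]
  refine Finset.sum_congr rfl fun v _ => ?_
  rw [Finset.sum_comm]
  refine Finset.sum_congr rfl fun v' _ => ?_
  rw [Finset.sum_comm]
  refine Finset.sum_congr rfl fun a _ => Finset.sum_congr rfl fun p _ => by ring

variable (H : ProjGame)

lemma prod_μL (p : G.U × H.U) : (G.prod H).μL p = G.μL p.1 * H.μL p.2 := by
  simp only [μL, prod, Finset.sum_mul_sum]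
  exact Fintype.sum_prod_type _

lemma prod_μc (p : G.U × H.U) (q : G.V × H.V) :
    (G.prod H).μc p q = G.μc p.1 q.1 * H.μc p.2 q.2 := by
  have e : (G.prod H).μc p q = G.μ p.1 q.1 * H.μ p.2 q.2 / (G.prod H).μL p := rfl
  rw [e, prod_μL]
  exact mul_div_mul_comm _ _ _ _

lemma prod_proj_eq_some (p : G.U × H.U) (q : G.V × H.V) (b : G.B × H.B) (a : G.A × H.A) :
    (G.prod H).proj p q b = some a ↔
      G.proj p.1 q.1 b.1 = some a.1 ∧ H.proj p.2 q.2 b.2 = some a.2 := by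
  obtain ⟨a, a'⟩ := a
  simp only [prod, Option.bind_eq_some_iff, Option.map_eq_some_iff, Prod.mk.injEq]
  constructor
  · rintro ⟨c, hc, c', hc', rfl, rfl⟩; exact ⟨hc, hc'⟩
  · rintro ⟨h1, h2⟩; exact ⟨a, h1, a', h2, rfl, rfl⟩

omit [Fintype ι] in
lemma fiber_prod (p : G.U × H.U) (q : G.V × H.V) (K : G.B × H.B → Matrix ι ι ℂ)
    (a : G.A × H.A) : fiber ((G.prod H).proj p q) K a =
      ∑ b, ∑ b', if G.proj p.1 q.1 b = some a.1 ∧ H.proj p.2 q.2 b' = some a.2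
        then K (b, b') else 0 :=
  (Fintype.sum_prod_type _).trans <| Finset.sum_congr rfl fun b _ => Finset.sum_congr rfl
    fun b' _ => if_congr (G.prod_proj_eq_some H p q (b, b') a) rfl rfl

omit [Fintype ι] in
lemma push_prod (K : G.V × H.V → G.B × H.B → Matrix ι ι ℂ) (u : G.U) (u' : H.U) (a : G.A)
    (a' : H.A) :
    (G.prod H).push K (u, u') (a, a') =
      G.push (fun v b => H.push (fun v' b' => K (v, v') (b, b')) u' a') u a := by
  refine (Fintype.sum_prod_type _).trans (Finset.sum_congr rfl fun v _ => ?_)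
  refine (Finset.sum_congr rfl fun v' _ => congrArg₂ (· • ·) (G.prod_μc H (u, u') (v, v'))
    (G.fiber_prod H (u, u') (v, v') (K (v, v')) (a, a'))).trans ?_
  simp only [push, fiber, mul_smul]
  rw [← Finset.smul_sum]
  congr 1
  simp only [Finset.smul_sum]
  rw [Finset.sum_comm]
  refine Finset.sum_congr rfl fun b _ => ?_
  split_ifs with h <;> simp [h]

lemma energy_prod (K : G.V × H.V → G.B × H.B → Matrix ι ι ℂ) :
    (G.prod H).energy K = ∑ p : H.U × H.A, H.μL p.1 *
      G.energy fun v b => H.push (fun v' b' => K (v, v') (b, b')) p.1 p.2 := by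
  have e : (G.prod H).energy K = ∑ u, ∑ u', G.μL u * H.μL u' * ∑ a, ∑ a',
      fsq (G.push (fun v b => H.push (fun v' b' => K (v, v') (b, b')) u' a') u a) := by
    refine (Fintype.sum_prod_type _).trans (Finset.sum_congr rfl fun u _ =>
      Finset.sum_congr rfl fun u' _ => ?_)
    refine congrArg₂ _ (G.prod_μL H (u, u')) ((Fintype.sum_prod_type _).trans ?_)
    exact Finset.sum_congr rfl fun a _ => Finset.sum_congr rfl fun a' _ =>
      congrArg fsq (G.push_prod H K u u' a a')
  rw [e, Finset.sum_comm, Fintype.sum_prod_type]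
  refine Finset.sum_congr rfl fun u' _ => ?_
  simp only [energy, Finset.mul_sum]
  refine Eq.trans (Finset.sum_congr rfl fun u _ => ?_) Finset.sum_comm
  rw [Finset.sum_comm]
  exact Finset.sum_congr rfl fun a' _ => Finset.sum_congr rfl fun a _ => by ring

variable {G H} in
lemma RelaxBound.prod {x y : ℝ} (hG : G.RelaxBound x) (hH : H.RelaxBound y) :
    (G.prod H).RelaxBound (x * y) := by
  intro ι _ _ K r hK hr
  have h := hG.sum_le (o := H.U × H.A) (w := fun p => H.μL p.1) (fun p => H.μL_nonneg p.1)
    (K := fun p v b => H.push (fun v' b' => K (v, v') (b, b')) p.1 p.2)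
    (fun p v b => H.push_posSemidef (fun v' b' => hK (v, v') (b, b')) p.1 p.2) (r := y * r) ?_
  · rw [mul_assoc]
    exact (G.energy_prod H K).trans_le h
  · intro v
    have h2 := hH ι (fun v' b' => ∑ b, K (v, v') (b, b')) r
      (fun v' b' => posSemidef_sum _ fun b _ => hK (v, v') (b, b')) fun v' => by
        rw [Finset.sum_comm]
        refine le_of_eq_of_le (congrArg fsq ?_) (hr (v, v'))
        exact (Fintype.sum_prod_type _).symm
    refine le_trans (le_of_eq ?_) h2
    simp only [Fintype.sum_prod_type, energy, Finset.mul_sum]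
    refine Finset.sum_congr rfl fun u' _ => Finset.sum_congr rfl fun a' _ => ?_
    congr 2
    simp only [push, fiber]
    rw [Finset.sum_comm]
    refine Finset.sum_congr rfl fun v' _ => ?_
    rw [← Finset.smul_sum, Finset.sum_comm]
    congr 1
    refine Finset.sum_congr rfl fun b' _ => ?_
    split_ifs <;> simp

variable {G} in
lemma RelaxBound.pow {x : ℝ} (hG : G.RelaxBound x) (k : ℕ) :
    (G.pow (k + 1)).RelaxBound (x ^ (k + 1)) := by
  induction k with
  | zero => rw [zero_add, pow_one]; exact hG
  | succ k ih => rw [pow_succ']; exact hG.prod ih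

end Relax

end ProjGame

/-! ### The relaxed value bounds the entangled value -/

lemma re_braket_kronecker {m n : Type*} [Fintype m] [Fintype n] (ψ : m × n → ℂ)
    (C : Matrix m m ℂ) (B : Matrix n n ℂ) :
    (braket ψ (C ⊗ₖ B)).re =
      fip (of fun i j => ψ (i, j)) (C * of (fun i j => ψ (i, j)) * Bᵀ) := by
  rw [braket, dotProduct, Fintype.sum_prod_type, Complex.re_sum, fip_eq_sum]
  refine Finset.sum_congr rfl fun i _ => ?_
  rw [Complex.re_sum]
  refine Finset.sum_congr rfl fun j _ => ?_
  congr 2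
  simp only [mulVec, dotProduct, Matrix.mul_apply, of_apply, transpose_apply, kronecker_apply,
    Fintype.sum_prod_type, Finset.sum_mul]
  rw [Finset.sum_comm]
  exact Finset.sum_congr rfl fun k _ => Finset.sum_congr rfl fun l _ => by ring

lemma enormSq_eq_fsq {m n : Type*} [Fintype m] [Fintype n] (ψ : m × n → ℂ) :
    enormSq ψ = fsq (of fun i j => ψ (i, j)) := by
  rw [enormSq, fsq_eq_sum, Fintype.sum_prod_type]
  rfl

lemma mconj_eq_transpose {n : Type*} {M : Matrix n n ℂ} (hM : M.IsHermitian) : mconj M = Mᵀ := by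
  ext i j
  exact hM.apply j i

lemma fip_transpose {m n : Type*} [Fintype m] [Fintype n] (M N : Matrix m n ℂ) :
    fip Mᵀ Nᵀ = fip M N := by
  rw [fip_eq_sum, fip_eq_sum, Finset.sum_comm]
  rfl

/-- Every square matrix `M` has Hermitian `R`, `W` with `R² = |M|`, `W MᴴM W = |M|` and `M W R = M`:
the square root of `|M|` and its pseudo-inverse. -/
lemma exists_sqrt_factors {n : Type*} [Fintype n] [DecidableEq n] (M : Matrix n n ℂ) :
    ∃ R W : Matrix n n ℂ, R.IsHermitian ∧ W.IsHermitian ∧ M * W * R = M ∧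
      W * (Mᴴ * M) * W = R * R ∧ fsq (R * R) = fsq M := by
  obtain ⟨U, σ, hU, hσ, hM⟩ := exists_eq_conjDiag (posSemidef_conjTranspose_mul_self M)
  obtain ⟨y, hy⟩ : ∃ y : n → ℝ, ∀ i, y i ^ 4 = σ i := by
    refine ⟨fun i => √√(σ i), fun i => ?_⟩
    rw [show (4 : ℕ) = 2 * 2 by norm_num, pow_mul, Real.sq_sqrt (Real.sqrt_nonneg _),
      Real.sq_sqrt (hσ i)]
  refine ⟨conjDiag U y, conjDiag U fun i => (y i)⁻¹, conjDiag_isHermitian _ _,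
    conjDiag_isHermitian _ _, ?_, ?_, ?_⟩
  · have h0 : M * (1 - conjDiag U fun i => (y i)⁻¹ * y i) = 0 := by
      apply eq_zero_of_fsq_eq_zero
      rw [fsq, fip_mul_left, ← Matrix.mul_assoc, hM, ← conjDiag_one hU, conjDiag_sub,
        conjDiag_mul hU]
      have e : (fun i => σ i * (1 - (y i)⁻¹ * y i)) = fun _ => 0 := by
        funext i
        rw [← hy i]
        by_cases h : y i = 0
        · simp [h]
        · rw [inv_mul_cancel₀ h]; ring
      rw [e, conjDiag_zero]
      simp
    rw [Matrix.mul_sub, Matrix.mul_one, sub_eq_zero] at h0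
    rw [Matrix.mul_assoc, conjDiag_mul hU]
    exact h0.symm
  · rw [hM, conjDiag_mul hU, conjDiag_mul hU, conjDiag_mul hU]
    congr 1
    funext i
    rw [← hy i]
    by_cases h : y i = 0
    · simp [h]
    · field_simp
  · have e : fsq M = ∑ i, σ i := by
      have h1 : fsq M = fip (conjDiag U fun _ => 1) (conjDiag U σ) := by
        rw [conjDiag_one hU, ← hM, fip_comm, fip_mul_left, conjTranspose_conjTranspose,
          Matrix.mul_one]
        rfl
      have h2 : fip (conjDiag U fun _ => 1) (conjDiag U σ) =
          fsq (conjDiag U fun i => y i * y i) := by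
        rw [fsq, ← conjDiag_mul hU y y, fip_mul_left' (conjDiag_isHermitian U y),
          fip_comm (conjDiag U y), fip_def, fip_def, (conjDiag_isHermitian U _).eq,
          conjTranspose_mul, conjTranspose_mul, (conjDiag_isHermitian U _).eq]
        simp only [conjDiag_mul hU]
        congr 3
        funext i
        rw [← hy i]; ring
      rw [h1, h2, fsq_conjDiag hU]
      exact Finset.sum_congr rfl fun i _ => by rw [← hy i]; ring
    rw [conjDiag_mul hU, fsq_conjDiag hU, e]
    exact Finset.sum_congr rfl fun i _ => by rw [← hy i]; ring

namespace ProjGame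

variable {G : ProjGame}

lemma pay_eq {d : ℕ} (A : G.U → G.A → Mat d) (B : G.V → G.B → Mat d) (ψ : Fin d × Fin d → ℂ) :
    G.pay A B ψ = ∑ u, G.μL u * ∑ a, fip (of fun i j => ψ (i, j))
      (mconj (A u a) * of (fun i j => ψ (i, j)) * G.push (fun v b => (B v b)ᵀ) u a) := by
  set M : Mat d := of fun i j => ψ (i, j) with hM
  refine Finset.sum_congr rfl fun u _ => ?_
  simp only [re_braket_kronecker, ← hM, ← G.μL_mul_μc u, mul_assoc, ← Finset.mul_sum]
  congr 1
  simp only [push, fiber, Finset.mul_sum]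
  rw [Finset.sum_comm]
  refine Finset.sum_congr rfl fun a _ => ?_
  rw [map_sum]
  refine Finset.sum_congr rfl fun v _ => ?_
  simp only [Matrix.mul_smul, map_smul, smul_eq_mul, Finset.mul_sum, map_sum]
  refine Finset.sum_congr rfl fun b _ => ?_
  split_ifs <;> simp

lemma push_mul_mul {ι : Type*} [Fintype ι] (X Y : Matrix ι ι ℂ) (K : G.V → G.B → Matrix ι ι ℂ)
    (u : G.U) (a : G.A) :
    G.push (fun v b => X * K v b * Y) u a = X * G.push K u a * Y := by
  simp only [push, fiber, Finset.mul_sum, Finset.sum_mul, Matrix.mul_smul, Matrix.smul_mul]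
  refine Finset.sum_congr rfl fun v _ => ?_
  congr 1
  refine Finset.sum_congr rfl fun b _ => ?_
  split_ifs <;> simp

lemma RelaxBound.pay_sq_le {x : ℝ} (h : G.RelaxBound x) {d : ℕ} {A : G.U → G.A → Mat d}
    {B : G.V → G.B → Mat d} {ψ : Fin d × Fin d → ℂ} (hA : G.IsStrategyA A)
    (hB : G.IsStrategyB B) (hψ : enormSq ψ = 1) : 0 ≤ G.pay A B ψ ∧ G.pay A B ψ ^ 2 ≤ x := by
  set M : Mat d := of fun i j => ψ (i, j) with hM
  rw [enormSq_eq_fsq, ← hM] at hψ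
  obtain ⟨R, W, hR, hW, hMWR, hW2, hR2⟩ := exists_sqrt_factors M
  rw [hψ] at hR2
  have hA' : ∀ u a, (mconj (A u a)).PosSemidef := fun u a => by
    rw [mconj_eq_transpose ((hA u).1 a).1]; exact ((hA u).1 a).transpose
  have hA1 : ∀ u, ∑ a, mconj (A u a) = 1 := fun u => by
    have e : ∑ a, mconj (A u a) = (∑ a, A u a)ᵀ := by
      rw [transpose_sum]
      exact Finset.sum_congr rfl fun a _ => mconj_eq_transpose ((hA u).1 a).1
    rw [e, (hA u).2, transpose_one]
  have hRK : ∀ {X : Mat d}, X.PosSemidef → (R * X * R).PosSemidef := fun hX => by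
    simpa only [hR.eq] using hX.mul_mul_conjTranspose_same R
  set L : G.U → G.A → Mat d := fun u a => W * (Mᴴ * mconj (A u a) * M) * W with hL
  have hLp : ∀ u a, (L u a).PosSemidef := fun u a => by
    have := ((hA' u a).conjTranspose_mul_mul_same M).mul_mul_conjTranspose_same W
    rwa [hW.eq] at this
  have hL1 : ∀ u, ∑ a, fsq (L u a) ≤ 1 := fun u => by
    have e : ∑ a, L u a = R * R := by
      rw [← hW2]
      simp only [hL]
      rw [← Finset.sum_mul, ← Finset.mul_sum, ← Finset.sum_mul, ← Finset.mul_sum, hA1,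
        Matrix.mul_one]
    have := sum_fip_le (X' := R * R) (Y' := R * R) (hLp u) (hLp u)
      (by rw [e, sub_self]; exact PosSemidef.zero) (by rw [e, sub_self]; exact PosSemidef.zero)
    exact this.trans hR2.le
  set K : G.V → G.B → Mat d := fun v b => R * (B v b)ᵀ * R with hK
  have hKp : ∀ v b, (K v b).PosSemidef := fun v b => hRK ((hB v).1 b).transpose
  have hpay : G.pay A B ψ = ∑ u, G.μL u * ∑ a, fip (L u a) (G.push K u a) := by
    rw [pay_eq, ← hM]
    refine Finset.sum_congr rfl fun u _ => ?_
    congr 1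
    refine Finset.sum_congr rfl fun a _ => ?_
    rw [push_mul_mul, ← fip_mul_right' hR, ← fip_mul_left' hR]
    have e : R * (L u a * R) = Mᴴ * (mconj (A u a) * M) := by
      have e1 : R * W * Mᴴ = Mᴴ := by
        have := congrArg conjTranspose hMWR
        rwa [conjTranspose_mul, conjTranspose_mul, hR.eq, hW.eq, ← Matrix.mul_assoc] at this
      calc R * (L u a * R) = (R * W * Mᴴ) * mconj (A u a) * (M * W * R) := by
            simp only [hL, Matrix.mul_assoc]
        _ = _ := by rw [e1, hMWR, Matrix.mul_assoc]
    rw [e, fip_mul_left, conjTranspose_conjTranspose, fip_mul_left' (hA' u a).1,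
      ← Matrix.mul_assoc]
  have hen := h (Fin d) K 1 hKp fun v => by
    have e : ∑ b, K v b = R * R := by
      simp only [hK]
      rw [← Finset.sum_mul, ← Finset.mul_sum, ← transpose_sum, (hB v).2, transpose_one,
        Matrix.mul_one]
    rw [e, hR2]
  rw [mul_one] at hen
  constructor
  · rw [hpay]
    exact Finset.sum_nonneg fun u _ => mul_nonneg (G.μL_nonneg u) <|
      Finset.sum_nonneg fun a _ => fip_nonneg (hLp u a) (G.push_posSemidef hKp u a)
  · set s := G.pay A B ψ
    have key : 2 * s * s ≤ s ^ 2 + x := by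
      calc 2 * s * s = ∑ u, G.μL u * ∑ a, 2 * fip (s • L u a) (G.push K u a) := by
            conv_lhs => rw [mul_assoc]; rhs; rhs; rw [hpay]
            simp only [Finset.mul_sum, map_smul, LinearMap.smul_apply, smul_eq_mul]
            exact Finset.sum_congr rfl fun u _ => Finset.sum_congr rfl fun a _ => by ring
        _ ≤ ∑ u, G.μL u * (s ^ 2 + ∑ a, fsq (G.push K u a)) := by
            refine Finset.sum_le_sum fun u _ => mul_le_mul_of_nonneg_left ?_ (G.μL_nonneg u)
            calc _ ≤ ∑ a, (fsq (s • L u a) + fsq (G.push K u a)) :=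
                  Finset.sum_le_sum fun a _ => two_mul_fip_le _ _
              _ = s ^ 2 * (∑ a, fsq (L u a)) + ∑ a, fsq (G.push K u a) := by
                  simp only [fsq_smul, Finset.sum_add_distrib, Finset.mul_sum]
              _ ≤ _ := by
                  have := mul_le_mul_of_nonneg_left (hL1 u) (sq_nonneg s)
                  linarith
        _ = s ^ 2 + G.energy K := by
            simp only [mul_add, Finset.sum_add_distrib, ← Finset.sum_mul, sum_μL, one_mul]
            rfl
        _ ≤ _ := by linarith
    linarith

lemma RelaxBound.entVal_le {x : ℝ} (h : G.RelaxBound x) : G.entVal ≤ √x := by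
  refine Real.sSup_le ?_ (Real.sqrt_nonneg x)
  rintro _ ⟨d, A, B, ψ, hA, hB, hψ, rfl⟩
  exact Real.le_sqrt_of_sq_le (h.pay_sq_le hA hB hψ).2

variable (G)

lemma entVal_nonneg : 0 ≤ G.entVal := by
  refine Real.sSup_nonneg ?_
  rintro _ ⟨d, A, B, ψ, hA, hB, hψ, rfl⟩
  exact (G.relaxBound_one.pay_sq_le hA hB hψ).1

lemma entVal_le_one : G.entVal ≤ 1 := by
  simpa using G.relaxBound_one.entVal_le

variable {G}

lemma pay_le_entVal {d : ℕ} {A : G.U → G.A → Mat d} {B : G.V → G.B → Mat d}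
    {ψ : Fin d × Fin d → ℂ} (hA : G.IsStrategyA A) (hB : G.IsStrategyB B) (hψ : enormSq ψ = 1) :
    G.pay A B ψ ≤ G.entVal := by
  refine le_csSup ⟨1, ?_⟩ ⟨d, A, B, ψ, hA, hB, hψ, rfl⟩
  rintro _ ⟨d, A, B, ψ, hA, hB, hψ, rfl⟩
  have := Real.le_sqrt_of_sq_le (G.relaxBound_one.pay_sq_le hA hB hψ).2
  rwa [Real.sqrt_one] at this

lemma energy_fin_div_card_le_entVal [Nonempty G.A] {d : ℕ} (hd : 0 < d)
    {B : G.V → G.B → Mat d} (hB : G.IsStrategyB B) : G.energy B / d ≤ G.entVal := by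
  classical
  obtain ⟨a₀⟩ := ‹Nonempty G.A›
  have hd' : (0 : ℝ) < d := by exact_mod_cast hd
  set P := G.push B
  have hP : ∀ u a, (P u a).PosSemidef := G.push_posSemidef fun v => (hB v).1
  have hrest : ∀ u, (1 - ∑ a, P u a).PosSemidef := by
    intro u
    have hμ : ∑ v, G.μc u v ≤ 1 := by
      simp only [μc, ← Finset.sum_div]
      exact div_self_le_one _
    have e : 1 - ∑ a, P u a = (1 - ∑ v, G.μc u v) • (1 : Mat d) +
        ∑ v, G.μc u v • (∑ b, B v b - ∑ a, fiber (G.proj u v) (B v) a) := by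
      simp only [P, push, (hB _).2, smul_sub, Finset.sum_sub_distrib, sub_smul, one_smul,
        ← Finset.sum_smul, Finset.smul_sum]
      rw [Finset.sum_comm]
      abel
    rw [e]
    exact (PosSemidef.one.smul (sub_nonneg.2 hμ)).add <| posSemidef_sum _ fun v _ =>
      (sum_sub_fiber_posSemidef (hB v).1 _).smul (G.μc_nonneg u v)
  set A : G.U → G.A → Mat d := fun u a => P u a + if a = a₀ then 1 - ∑ a, P u a else 0 with hA
  have hite : ∀ u a, (if a = a₀ then 1 - ∑ a, P u a else 0 : Mat d).PosSemidef := by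
    intro u a
    split_ifs
    exacts [hrest u, PosSemidef.zero]
  have hAs : G.IsStrategyA A := fun u =>
    ⟨fun a => (hP u a).add (hite u a), by simp [hA, Finset.sum_add_distrib]⟩
  set ψ : Fin d × Fin d → ℂ := fun p => if p.1 = p.2 then ((√d)⁻¹ : ℝ) else 0 with hψdef
  have hM : (of fun i j => ψ (i, j)) = (√(d : ℝ))⁻¹ • (1 : Mat d) := by
    ext i j
    simp only [hψdef, of_apply, Matrix.smul_apply, one_apply]
    split_ifs <;> simp
  have hs : (√(d : ℝ))⁻¹ * (√(d : ℝ))⁻¹ = (d : ℝ)⁻¹ := by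
    rw [← mul_inv, Real.mul_self_sqrt hd'.le]
  have hψ : enormSq ψ = 1 := by
    rw [enormSq_eq_fsq, hM, fsq_smul, sq, hs, fsq, fip_one_one, Fintype.card_fin]
    exact inv_mul_cancel₀ hd'.ne'
  refine le_trans ?_ (pay_le_entVal hAs hB hψ)
  rw [pay_eq, hM, energy, Finset.sum_div]
  refine Finset.sum_le_sum fun u _ => ?_
  rw [mul_div_assoc]
  refine mul_le_mul_of_nonneg_left ?_ (G.μL_nonneg u)
  rw [Finset.sum_div]
  refine Finset.sum_le_sum fun a _ => ?_
  have e : fip ((√(d : ℝ))⁻¹ • (1 : Mat d)) (mconj (A u a) * (√(d : ℝ))⁻¹ • 1 *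
      G.push (fun v b => (B v b)ᵀ) u a) = fip (A u a) (P u a) / d := by
    have e1 : G.push (fun v b => (B v b)ᵀ) u a = (P u a)ᵀ := by
      simp only [P, push, fiber, transpose_sum, transpose_smul]
      refine Finset.sum_congr rfl fun v _ => ?_
      congr 1
      refine Finset.sum_congr rfl fun b _ => ?_
      split_ifs <;> simp
    have hAp := (hAs u).1 a
    rw [e1, mconj_eq_transpose hAp.1, Matrix.mul_smul, Matrix.smul_mul, Matrix.mul_one,
      map_smul, map_smul, LinearMap.smul_apply, smul_eq_mul, smul_eq_mul, ← mul_assoc, hs,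
      ← fip_mul_left' hAp.transpose.1, Matrix.mul_one, fip_transpose, inv_mul_eq_div]
  rw [e]
  gcongr
  have := fip_nonneg (hite u a) (hP u a)
  simp only [hA, map_add, LinearMap.add_apply]
  rw [fsq]
  exact le_add_of_nonneg_right this

lemma energy_div_card_le_entVal [Nonempty G.A] {κ : Type*} [Fintype κ] [DecidableEq κ]
    [Nonempty κ] {B : G.V → G.B → Matrix κ κ ℂ} (hB : ∀ v b, (B v b).PosSemidef)
    (hB1 : ∀ v, ∑ b, B v b = 1) : G.energy B / Fintype.card κ ≤ G.entVal := by
  set e := (Fintype.equivFin κ).symm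
  set f : Matrix κ κ ℂ →+ Mat (Fintype.card κ) :=
    AddMonoidHom.mk' (fun M => M.submatrix e e) fun _ _ => rfl with hf
  have hfip : ∀ M N : Matrix κ κ ℂ, fip (f M) (f N) = fip M N := fun M N => by
    rw [fip_eq_sum, fip_eq_sum, ← e.sum_comp]
    exact Finset.sum_congr rfl fun i _ => e.sum_comp fun j => (star (M (e i) j) * N (e i) j).re
  have hE : G.energy (fun v b => f (B v b)) = G.energy B := by
    simp only [energy_eq_avg, corr, ← fiber_map, hfip]
  rw [← hE]
  refine energy_fin_div_card_le_entVal Fintype.card_pos fun v =>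
    ⟨fun b => (hB v b).submatrix e, ?_⟩
  rw [← map_sum, hB1]
  exact submatrix_one_equiv e

end ProjGame

/-! ### Rounding relaxed strategies -/

section Trunc

variable {n : Type*} [Fintype n] [DecidableEq n]

/-- Positive semidefinite matrices `K b` factor as `H Q_b H`, where `Q` is a sub-POVM and `H` is
the square root of `∑ b, K b`. -/
lemma exists_isSubPOVM_mul_mul {β : Type*} [Fintype β] {K : β → Matrix n n ℂ}
    (hK : ∀ b, (K b).PosSemidef) :
    ∃ (U : Matrix n n ℂ) (x : n → ℝ) (Q : β → Matrix n n ℂ), Uᴴ * U = 1 ∧ (∀ i, 0 ≤ x i) ∧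
      ∑ b, K b = conjDiag U x ∧ IsSubPOVM Q ∧
      ∀ b, conjDiag U (fun i => √(x i)) * Q b * conjDiag U (fun i => √(x i)) = K b := by
  obtain ⟨U, x, hU, hx, hKx⟩ := exists_eq_conjDiag (posSemidef_sum Finset.univ fun b _ => hK b)
  set H := conjDiag U fun i => √(x i)
  set G := conjDiag U fun i => (√(x i))⁻¹
  set E := conjDiag U fun i => 1 - (√(x i))⁻¹ * √(x i)
  have hG : G.IsHermitian := conjDiag_isHermitian _ _
  have hE : E.IsHermitian := conjDiag_isHermitian _ _
  have hcases : ∀ i, √(x i) = 0 ∧ x i = 0 ∨ √(x i) ≠ 0 ∧ x i = √(x i) * √(x i) := fun i => by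
    by_cases h : √(x i) = 0
    · exact Or.inl ⟨h, (Real.sqrt_eq_zero (hx i)).1 h⟩
    · exact Or.inr ⟨h, (Real.mul_self_sqrt (hx i)).symm⟩
  have hEp : E.PosSemidef := conjDiag_posSemidef U fun i => by
    rcases hcases i with ⟨h, -⟩ | ⟨h, -⟩ <;> simp [h]
  have hEE : E * E = E := by
    rw [conjDiag_mul hU]
    congr 1; funext i
    rcases hcases i with ⟨h, -⟩ | ⟨h, -⟩ <;> simp [h]
  have hE1 : E = 1 - G * H := by
    rw [conjDiag_mul hU, ← conjDiag_one hU, conjDiag_sub]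
  have hfip0 : ∑ b, fip E (K b) = 0 := by
    rw [← map_sum, hKx, fip_def, hE.eq, conjDiag_mul hU]
    have e : (fun i => (1 - (√(x i))⁻¹ * √(x i)) * x i) = fun _ => 0 := by
      funext i
      rcases hcases i with ⟨-, h⟩ | ⟨h, -⟩ <;> simp [h]
    simp [e, conjDiag_zero]
  have hKE : ∀ b, K b * E = 0 := fun b => by
    obtain ⟨B, hB⟩ : ∃ B : Matrix n n ℂ, K b = Bᴴ * B := by
      open scoped MatrixOrder in
      have := CStarAlgebra.nonneg_iff_eq_star_mul_self.mp (hK b).nonneg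
      simpa [Matrix.star_eq_conjTranspose] using this
    have h0 : fip E (K b) = 0 :=
      (Finset.sum_eq_zero_iff_of_nonneg fun b _ => fip_nonneg hEp (hK b)).1 hfip0 b
        (Finset.mem_univ b)
    have hBE : B * E = 0 := by
      apply eq_zero_of_fsq_eq_zero
      rw [fsq, fip_mul_left, ← Matrix.mul_assoc, ← hB, ← fip_mul_right' hE, hEE, h0]
    rw [hB, Matrix.mul_assoc, hBE, Matrix.mul_zero]
  have hKGH : ∀ b, K b * (G * H) = K b := fun b => by
    have := hKE b
    rw [hE1, Matrix.mul_sub, Matrix.mul_one, sub_eq_zero] at this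
    exact this.symm
  have hHGK : ∀ b, H * G * K b = K b := fun b => by
    have := congrArg conjTranspose (hKGH b)
    rwa [conjTranspose_mul, conjTranspose_mul, (hK b).1.eq, hG.eq,
      (conjDiag_isHermitian U _).eq] at this
  refine ⟨U, x, fun b => G * K b * G, hU, hx, hKx, ⟨fun b => ?_, ?_⟩, fun b => ?_⟩
  · simpa only [hG.eq] using (hK b).mul_mul_conjTranspose_same G
  · rw [← Finset.sum_mul, ← Finset.mul_sum, hKx, conjDiag_mul hU, conjDiag_mul hU,
      ← conjDiag_one hU, conjDiag_sub]
    refine conjDiag_posSemidef U fun i => ?_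
    rcases hcases i with ⟨-, h⟩ | ⟨h, h'⟩
    · simp [h]
    · have e : ∀ y z : ℝ, y ≠ 0 → z = y * y → y⁻¹ * z * y⁻¹ = 1 := by
        rintro y _ hy rfl
        field_simp
      rw [e _ _ h h', sub_self]
  · calc H * (G * K b * G) * H = H * G * K b * (G * H) := by simp only [Matrix.mul_assoc]
      _ = K b := by rw [hHGK, hKGH]

/-- Direct sum of the compressions of a matrix to the spectral subspaces given by `thr m j`. -/
def truncate (m : ℕ) (U : Matrix n n ℂ) (x : n → ℝ) :
    Matrix n n ℂ →+ Matrix (n × Fin m) (n × Fin m) ℂ :=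
  AddMonoidHom.mk' (fun M => blockDiagonal fun j =>
    conjDiag U (fun i => thr m j (x i)) * M * conjDiag U (fun i => thr m j (x i)))
    fun M N => by simp only [Matrix.mul_add, Matrix.add_mul, ← blockDiagonal_add]; rfl

lemma truncate_apply (m : ℕ) (U : Matrix n n ℂ) (x : n → ℝ) (M : Matrix n n ℂ) :
    truncate m U x M = blockDiagonal fun j =>
      conjDiag U (fun i => thr m j (x i)) * M * conjDiag U (fun i => thr m j (x i)) :=
  rfl

lemma truncate_posSemidef (m : ℕ) (U : Matrix n n ℂ) (x : n → ℝ) {M : Matrix n n ℂ}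
    (hM : M.PosSemidef) : (truncate m U x M).PosSemidef :=
  blockDiagonal_posSemidef fun j => by
    simpa only [(conjDiag_isHermitian U _).eq] using
      hM.mul_mul_conjTranspose_same (conjDiag U fun i => thr m j (x i))

lemma truncate_one {m : ℕ} {U : Matrix n n ℂ} (hU : Uᴴ * U = 1) (x : n → ℝ) :
    truncate m U x 1 = blockDiagonal fun j : Fin m => conjDiag U (fun i => thr m j (x i)) := by
  simp only [truncate_apply, Matrix.mul_one, conjDiag_mul hU, thr_mul_self]

lemma one_sub_truncate_one_posSemidef {m : ℕ} {U : Matrix n n ℂ} (hU : Uᴴ * U = 1) (x : n → ℝ) :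
    (1 - truncate m U x 1).PosSemidef := by
  rw [truncate_one hU, ← blockDiagonal_one, ← blockDiagonal_sub]
  refine blockDiagonal_posSemidef fun j => ?_
  rw [Pi.sub_apply, Pi.one_apply, ← conjDiag_one hU, conjDiag_sub]
  refine conjDiag_posSemidef U fun i => ?_
  unfold thr
  split_ifs <;> simp

lemma IsSubPOVM.truncate {β : Type*} [Fintype β] {Q : β → Matrix n n ℂ} (hQ : IsSubPOVM Q)
    (m : ℕ) {U : Matrix n n ℂ} (hU : Uᴴ * U = 1) (x : n → ℝ) :
    IsSubPOVM fun b => _root_.truncate m U x (Q b) := by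
  refine ⟨fun b => truncate_posSemidef m U x (hQ.1 b), ?_⟩
  have := (one_sub_truncate_one_posSemidef (m := m) hU x).add (truncate_posSemidef m U x hQ.2)
  simpa using this

lemma IsSubPOVM.fip_one_truncate_le {β : Type*} [Fintype β] {Q : β → Matrix n n ℂ}
    (hQ : IsSubPOVM Q) (m : ℕ) {U : Matrix n n ℂ} (hU : Uᴴ * U = 1) {x : n → ℝ}
    (hx1 : ∑ i, x i ^ 2 ≤ 1) : fip 1 (∑ b, _root_.truncate m U x (Q b)) ≤ m := by
  have h1 := fip_nonneg PosSemidef.one (truncate_posSemidef m U x hQ.2)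
  rw [map_sub, map_sub, map_sum, sub_nonneg] at h1
  refine h1.trans (le_trans (le_of_eq ?_) (sum_fsq_thr_le hU hx1))
  rw [truncate_one hU, ← blockDiagonal_one, fip_blockDiagonal]
  refine Finset.sum_congr rfl fun j _ => ?_
  rw [Pi.one_apply, fsq, fip_def, fip_def, (conjDiag_isHermitian U _).eq, conjDiag_mul hU,
    conjTranspose_one, Matrix.one_mul]
  simp only [thr_mul_self]

end Trunc

namespace ProjGame

variable {G : ProjGame}

lemma one_sub_entVal_le [Nonempty G.A] [Nonempty G.B] {ι : Type} [Fintype ι] [DecidableEq ι]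
    [Nonempty ι] {K : G.V → G.B → Matrix ι ι ℂ} (hK : ∀ v b, (K v b).PosSemidef)
    (hK1 : ∀ v, fsq (∑ b, K v b) ≤ 1) {s : ℝ} (hs : 0 < s) (hs1 : s ≤ 1) :
    1 - G.entVal ≤ 22 * s + 24 * ((1 - G.energy K) / s ^ 3) := by
  choose U x Q hU hx hKx hQ hQK using fun v => exists_isSubPOVM_mul_mul (hK v)
  have hx1 : ∀ v, ∑ i, x v i ^ 2 ≤ 1 := fun v => by
    rw [← fsq_conjDiag (hU v), ← hKx]; exact hK1 v
  set D : ℝ := (Fintype.card ι : ℝ)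
  have hD : 1 ≤ D := Nat.one_le_cast.2 Fintype.card_pos
  have hD0 : 0 < D := by linarith
  have hcorr : ∀ (m : ℕ) u v v', m * (1 - 11 * s - 12 *
      ((1 - corr (G.proj u v) (G.proj u v') (K v) (K v')) / s ^ 3)) - 4 * (D / s) ≤
      corr (G.proj u v) (G.proj u v') (fun b => truncate m (U v) (x v) (Q v b))
        (fun b => truncate m (U v') (x v') (Q v' b)) := by
    intro m u v v'
    have hfib : ∀ v a, conjDiag (U v) (fun i => √(x v i)) * fiber (G.proj u v) (Q v) a *
        conjDiag (U v) (fun i => √(x v i)) = fiber (G.proj u v) (K v) a := by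
      intro v a
      have := fiber_map (AddMonoidHom.mk' (fun M => conjDiag (U v) (fun i => √(x v i)) * M *
        conjDiag (U v) (fun i => √(x v i))) fun M N => by rw [Matrix.mul_add, Matrix.add_mul])
        (G.proj u v) (Q v) a
      simpa only [AddMonoidHom.mk'_apply, hQK] using this
    have := le_sum_fip_thr (m := m)
      (ε := 1 - corr (G.proj u v) (G.proj u v') (K v) (K v')) (hU v) (hU v') (hx v) (hx v')
      (hx1 v) (hx1 v') ((hQ v).fiber (G.proj u v)) ((hQ v').fiber (G.proj u v')) hs hs1
      (by simp only [hfib]; rw [sub_sub_cancel, corr])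
    refine this.trans (le_of_eq ?_)
    rw [Finset.sum_comm, corr]
    refine Finset.sum_congr rfl fun a _ => ?_
    rw [← fiber_map, ← fiber_map, truncate_apply, truncate_apply, fip_blockDiagonal]
  have key : ∀ N : ℕ, 1 - 22 * s - 24 * ((1 - G.energy K) / s ^ 3) - 8 * D / s * (1 / (N + 1)) -
      (1 - D⁻¹ / 2) ^ N ≤ G.entVal := by
    intro N
    have hN : (0 : ℝ) < N + 1 := by positivity
    obtain ⟨k, _, _, _, S, hS, hS1, hST⟩ := exists_povm_of_subPOVM (α := G.A)
      (fun v => (hQ v).truncate (N + 1) (hU v) (x v)) (p := D⁻¹) (by positivity)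
      (inv_le_one_of_one_le₀ hD) (fun v => by
        refine ((hQ v).fip_one_truncate_le (N + 1) (hU v) (hx1 v)).trans (le_of_eq ?_)
        rw [Fintype.card_prod, Fintype.card_fin, Nat.cast_mul]
        exact (inv_mul_cancel_left₀ hD0.ne' _).symm) N
    refine le_trans ?_ (energy_div_card_le_entVal hS hS1)
    have eS : G.energy S / Fintype.card k = G.avg fun u v v' =>
        0 + (Fintype.card k : ℝ)⁻¹ * corr (G.proj u v) (G.proj u v') (S v) (S v') := by
      rw [avg_affine, zero_add, ← energy_eq_avg, div_eq_inv_mul]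
    have e : 1 - 22 * s - 24 * ((1 - G.energy K) / s ^ 3) - 8 * D / s * (1 / (N + 1)) -
      (1 - D⁻¹ / 2) ^ N = (1 - 22 * s - 24 * (1 / s ^ 3) - 8 * D / s * (1 / (N + 1)) -
      (1 - D⁻¹ / 2) ^ N) + 24 / s ^ 3 * G.energy K := by ring
    rw [eS, e, G.energy_eq_avg K, ← avg_affine]
    refine G.avg_mono fun u v v' => ?_
    rw [zero_add, ← div_eq_inv_mul]
    refine le_trans ?_ (hST v v' (G.proj u v) (G.proj u v'))
    have h := hcorr (N + 1) u v v'
    set c := corr (G.proj u v) (G.proj u v') (K v) (K v')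
    set c' := corr (G.proj u v) (G.proj u v') (fun b => truncate (N + 1) (U v) (x v) (Q v b))
      fun b => truncate (N + 1) (U v') (x v') (Q v' b)
    have e1 : 2 * (c' / (Fintype.card (ι × Fin (N + 1)) : ℕ)) / D⁻¹ = 2 * c' / (N + 1) := by
      rw [Fintype.card_prod, Fintype.card_fin]
      push_cast
      change 2 * (c' / (D * (N + 1))) / D⁻¹ = _
      field_simp
    rw [e1]
    have h2 : 2 * (1 - 11 * s - 12 * ((1 - c) / s ^ 3)) - 8 * D / s * (1 / (N + 1)) ≤
        2 * c' / (N + 1) := by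
      rw [le_div_iff₀ hN]
      push_cast at h
      calc _ = 2 * ((N + 1) * (1 - 11 * s - 12 * ((1 - c) / s ^ 3)) - 4 * (D / s)) := by
            field_simp
            ring
        _ ≤ _ := by linarith
    have e2 : 24 / s ^ 3 * c = 24 * (1 / s ^ 3) - 24 * ((1 - c) / s ^ 3) := by ring
    linarith
  have hlim : Filter.Tendsto (fun N : ℕ => 1 - 22 * s - 24 * ((1 - G.energy K) / s ^ 3) -
      8 * D / s * (1 / (N + 1)) - (1 - D⁻¹ / 2) ^ N) Filter.atTop
      (nhds (1 - 22 * s - 24 * ((1 - G.energy K) / s ^ 3) - 8 * D / s * 0 - 0)) := by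
    refine (tendsto_const_nhds.sub (tendsto_one_div_add_atTop_nhds_zero_nat.const_mul _)).sub
      (tendsto_pow_atTop_nhds_zero_of_lt_one ?_ ?_)
    · have := inv_le_one_of_one_le₀ hD
      linarith
    · have : 0 < D⁻¹ := by positivity
      linarith
  have := le_of_tendsto' hlim key
  linarith

lemma energy_le_of_fsq_le_one {ι : Type} [Fintype ι] [DecidableEq ι]
    {K : G.V → G.B → Matrix ι ι ℂ} (hK : ∀ v b, (K v b).PosSemidef)
    (hK1 : ∀ v, fsq (∑ b, K v b) ≤ 1) :
    G.energy K ≤ 1 - 1 / (48 * 44 ^ 3) * (1 - G.entVal) ^ 4 := by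
  have h0 := G.entVal_nonneg
  have h1 := G.entVal_le_one
  have hrhs : 0 ≤ 1 - 1 / (48 * 44 ^ 3) * (1 - G.entVal) ^ 4 := by
    have := pow_le_one₀ (n := 4) (sub_nonneg.2 h1) (by linarith : 1 - G.entVal ≤ 1)
    linarith
  rcases isEmpty_or_nonempty G.A with hA | hA
  · simpa [energy] using hrhs
  rcases isEmpty_or_nonempty G.B with hB | hB
  · simpa [energy, push, fiber, fsq] using hrhs
  rcases isEmpty_or_nonempty ι with hι | hι
  · simpa [energy, fsq_eq_sum] using hrhs
  rcases h1.eq_or_lt with h | h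
  · have := G.relaxBound_one ι K 1 hK hK1
    rw [h]
    linarith
  · set t := 1 - G.entVal
    have ht : 0 < t := sub_pos.2 h
    have key := one_sub_entVal_le hK hK1 (s := t / 44) (by positivity)
      (by simp only [t]; linarith)
    have e : 24 * ((1 - G.energy K) / (t / 44) ^ 3) =
        (24 * 44 ^ 3) * (1 - G.energy K) / t ^ 3 := by
      field_simp
    rw [e, ← sub_le_iff_le_add', le_div_iff₀ (by positivity)] at key
    have e2 : (t - 22 * (t / 44)) * t ^ 3 = t ^ 4 / 2 := by ring
    change (t - 22 * (t / 44)) * t ^ 3 ≤ _ at key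
    linarith

lemma relaxBound_entVal (G : ProjGame) :
    G.RelaxBound (1 - 1 / (48 * 44 ^ 3) * (1 - G.entVal) ^ 4) := by
  intro ι _ _ K r hK hr
  have hscale : ∀ q : ℝ, r < q → 0 < q →
      G.energy K ≤ (1 - 1 / (48 * 44 ^ 3) * (1 - G.entVal) ^ 4) * q := by
    intro q hq hq0
    have hs : (√q)⁻¹ ^ 2 = q⁻¹ := by rw [inv_pow, Real.sq_sqrt hq0.le]
    have := energy_le_of_fsq_le_one (K := fun v b => (√q)⁻¹ • K v b)
      (fun v b => (hK v b).smul (by positivity)) fun v => by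
        rw [← Finset.smul_sum, fsq_smul, hs, inv_mul_le_iff₀ hq0, mul_one]
        exact (hr v).trans hq.le
    have e : G.energy (fun v b => (√q)⁻¹ • K v b) = q⁻¹ * G.energy K := by
      simp only [energy, Finset.mul_sum]
      refine Finset.sum_congr rfl fun u _ => Finset.sum_congr rfl fun a _ => ?_
      have : G.push (fun v b => (√q)⁻¹ • K v b) u a = (√q)⁻¹ • G.push K u a := by
        simp only [push, fiber, Finset.smul_sum]
        refine Finset.sum_congr rfl fun v _ => Finset.sum_congr rfl fun b _ => ?_
        split_ifs
        · exact smul_comm _ _ _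
        · simp
      rw [this, fsq_smul, hs]
      ring
    rw [e, inv_mul_le_iff₀ hq0] at this
    linarith
  have hr0 : 0 ≤ r := by
    by_contra hneg
    have : IsEmpty G.V := ⟨fun v => hneg ((fsq_nonneg _).trans (hr v))⟩
    simpa using G.μ_sum
  refine le_of_forall_pos_le_add fun ε hε => (hscale (r + ε) (by linarith) (by linarith)).trans ?_
  have : 0 ≤ 1 / (48 * 44 ^ 3) * (1 - G.entVal) ^ 4 * ε := by positivity
  linarith

end ProjGame

/-- **Parallel repetition for entangled projection games.**
There exist universal constants `C > 0` and `c ≥ 1` such that for every projection game `G`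
and every `k ≥ 1`, `val*(G^{⊗k}) ≤ (1 − C(1 − val*(G))^c)^{k/2}`. -/
theorem parallel_repetition_entangled_projection_games :
    ∃ C c : ℝ, 0 < C ∧ 1 ≤ c ∧ ∀ (G : ProjGame) (k : ℕ), 1 ≤ k →
      (G.pow k).entVal ≤ (1 - C * (1 - G.entVal) ^ c) ^ ((k : ℝ) / 2) := by
  refine ⟨1 / (48 * 44 ^ 3), 4, by norm_num, by norm_num, fun G k hk => ?_⟩
  obtain ⟨n, rfl⟩ : ∃ n, k = n + 1 := ⟨k - 1, by omega⟩
  have h0 := G.entVal_nonneg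
  have h1 := G.entVal_le_one
  have hx : 0 ≤ 1 - 1 / (48 * 44 ^ 3) * (1 - G.entVal) ^ 4 := by
    have := pow_le_one₀ (n := 4) (sub_nonneg.2 h1) (by linarith : 1 - G.entVal ≤ 1)
    linarith
  have h := (ProjGame.RelaxBound.pow G.relaxBound_entVal n).entVal_le
  rw [Real.rpow_ofNat, div_eq_mul_one_div ((n + 1 : ℕ) : ℝ) 2, Real.rpow_mul hx, Real.rpow_natCast,
    ← Real.sqrt_eq_rpow]
  exact h
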